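/- arXiv:1206.3221 — 14 statements merged into one kernel-verified Lean document; each statement's English description precedes it below -/
import Mathlib

section
/- For every nonnegative integer g, the map sending [g_1, …, g_k] to [⌊α_1·g⌋ − g_1, …, ⌊α_k·g⌋ − g_k] is a bijection from the set of α-communal compositions of g onto the set of k-tuples of nonnegative integers whose entries sum to s_g := Σ_{i=1}^k ⌊α_i·g⌋ − g. -/
/-- For every nonnegative integer `g`, the map sending
`[g₁, …, g_k]` to `[⌊α₁·g⌋ − g₁, …, ⌊α_k·g⌋ − g_k]` is a bijection from the set
of α-communal compositions of `g` onto the set of k-tuples of nonnegative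
integers whose entries sum to `s_g := ∑ i, ⌊α i * g⌋ - g`. -/
theorem stmt_1 (k : ℕ) (hk : 2 ≤ k) (α : Fin k → ℚ)
    (h1 : ∀ j : Fin k, ∑ i ∈ Finset.univ.erase j, α i ≤ 1)
    (h2 : 1 < ∑ i, α i) (g : ℕ) :
    Set.BijOn (fun (t : Fin k → ℕ) (i : Fin k) => ⌊α i * (g : ℚ)⌋ - (t i : ℤ))
      {t : Fin k → ℕ | (∑ i, t i) = g ∧ ∀ i, (t i : ℚ) ≤ α i * g}
      {e : Fin k → ℤ | (∀ i, 0 ≤ e i) ∧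
        (∑ i, e i) = (∑ i, ⌊α i * (g : ℚ)⌋) - (g : ℤ)} := by
  refine ⟨?_, ?_, ?_⟩
  · rintro t ⟨hsum, hle⟩
    refine ⟨fun i => sub_nonneg.mpr (Int.le_floor.mpr (by exact_mod_cast hle i)), ?_⟩
    rw [Finset.sum_sub_distrib, ← Nat.cast_sum, hsum]
  · intro t _ u _ h
    funext i
    have hi := congrFun h i
    simp only at hi
    omega
  · rintro e ⟨he, hsum⟩
    have hnonneg : ∀ j, 0 ≤ ⌊α j * (g : ℚ)⌋ - e j := by
      intro j
      have hfloor : ∑ i ∈ Finset.univ.erase j, ⌊α i * (g : ℚ)⌋ ≤ (g : ℤ) := by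
        have hq : ((∑ i ∈ Finset.univ.erase j, ⌊α i * (g : ℚ)⌋ : ℤ) : ℚ) ≤ g := by
          push_cast
          calc ∑ i ∈ Finset.univ.erase j, (⌊α i * (g : ℚ)⌋ : ℚ)
              ≤ ∑ i ∈ Finset.univ.erase j, α i * (g : ℚ) :=
                Finset.sum_le_sum fun i _ => Int.floor_le _
            _ = (∑ i ∈ Finset.univ.erase j, α i) * g := (Finset.sum_mul ..).symm
            _ ≤ g := mul_le_of_le_one_left (Nat.cast_nonneg g) (h1 j)
        exact_mod_cast hq
      have hrest : 0 ≤ ∑ i ∈ Finset.univ.erase j, e i :=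
        Finset.sum_nonneg fun i _ => he i
      rw [← Finset.add_sum_erase _ e (Finset.mem_univ j),
        ← Finset.add_sum_erase _ (fun i => ⌊α i * (g : ℚ)⌋) (Finset.mem_univ j)] at hsum
      linarith
    have hcast : ∀ i, ((⌊α i * (g : ℚ)⌋ - e i).toNat : ℤ) = ⌊α i * (g : ℚ)⌋ - e i :=
      fun i => Int.toNat_of_nonneg (hnonneg i)
    refine ⟨fun i => (⌊α i * (g : ℚ)⌋ - e i).toNat, ⟨?_, fun i => ?_⟩, ?_⟩
    · zify
      simp only [hcast, Finset.sum_sub_distrib, hsum]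
      ring
    · have hle : ((⌊α i * (g : ℚ)⌋ - e i).toNat : ℤ) ≤ ⌊α i * (g : ℚ)⌋ := by
        rw [hcast]
        linarith [he i]
      exact_mod_cast Int.le_floor.mp hle
    · funext i
      simp only [hcast, sub_sub_cancel]
end

section
/- For every nonnegative integer g, the number of α-communal compositions of g equals the binomial coefficient C(Σ_{i=1}^k ⌊α_i·g⌋ − g + k − 1, k − 1). -/
/-- Stars and bars: the number of functions `ι → ℕ` with total mass `n`. -/
theorem card_fun_sum_eq {ι : Type*} [Fintype ι] (n : ℕ) :
    Nat.card {s : ι → ℕ // ∑ i, s i = n} = (Fintype.card ι + n - 1).choose n := by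
  classical
  rw [← Nat.card_congr (Sym.equivNatSumOfFintype ι n), Nat.card_eq_fintype_card,
    Sym.card_sym_eq_choose]

/-- Complementation `t ↦ m - t` between functions bounded by `m` of total mass `g` and functions
of total mass `n`, where `g + n` is the total mass of `m` and every value of `m` is at least `n`. -/
def boundedSumEquiv {ι : Type*} [Fintype ι] (m : ι → ℕ) (g n : ℕ)
    (hsum : g + n = ∑ i, m i) (hle : ∀ i, n ≤ m i) :
    {t : ι → ℕ // ∑ i, t i = g ∧ ∀ i, t i ≤ m i} ≃ {s : ι → ℕ // ∑ i, s i = n} where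
  toFun t := ⟨fun i => m i - t.1 i, by
    rw [Finset.sum_tsub_distrib _ fun i _ => t.2.2 i, t.2.1]
    omega⟩
  invFun s := ⟨fun i => m i - s.1 i, by
    have hs : ∀ i, s.1 i ≤ m i := fun i =>
      ((Finset.single_le_sum (fun _ _ => Nat.zero_le _) (Finset.mem_univ i)).trans
        s.2.le).trans (hle i)
    refine ⟨?_, fun i => Nat.sub_le _ _⟩
    rw [Finset.sum_tsub_distrib _ fun i _ => hs i, s.2]
    omega⟩
  left_inv t := by
    ext i
    exact Nat.sub_sub_self (t.2.2 i)
  right_inv s := by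
    ext i
    exact Nat.sub_sub_self
      (((Finset.single_le_sum (fun _ _ => Nat.zero_le _) (Finset.mem_univ i)).trans
        s.2.le).trans (hle i))

/-- The number of α-communal compositions of `g` equals the
binomial coefficient `C(∑ i, ⌊α i * g⌋ - g + k - 1, k - 1)`. -/
theorem stmt_2 (k : ℕ) (hk : 2 ≤ k) (α : Fin k → ℚ)
    (h1 : ∀ j : Fin k, ∑ i ∈ Finset.univ.erase j, α i ≤ 1)
    (h2 : 1 < ∑ i, α i) (g : ℕ) :
    Nat.card {t : Fin k → ℕ // (∑ i, t i) = g ∧ ∀ i, (t i : ℚ) ≤ α i * g}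
      = ((∑ i, ⌊α i * (g : ℚ)⌋) - (g : ℤ) + (k : ℤ) - 1).toNat.choose (k - 1) := by
  have hpos : ∀ j, 0 ≤ α j * g := fun j => by
    have := Finset.add_sum_erase Finset.univ α (Finset.mem_univ j)
    have : 0 ≤ α j := by linarith [h1 j]
    positivity
  obtain ⟨m, hm⟩ : ∃ m : Fin k → ℕ, ∀ i, ⌊α i * (g : ℚ)⌋ = m i :=
    ⟨fun i => ⌊α i * (g : ℚ)⌋.toNat, fun i =>
      (Int.toNat_of_nonneg (Int.floor_nonneg.2 (hpos i))).symm⟩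
  have hbound : ∀ (t : ℕ) i, (t : ℚ) ≤ α i * g ↔ t ≤ m i := fun t i => by
    rw [← Int.cast_natCast, ← Int.le_floor, hm, Nat.cast_le]
  simp only [hm, hbound]
  rw [← Nat.cast_sum]
  rcases lt_or_ge (∑ i, m i) g with hlt | hge
  · have : IsEmpty {t : Fin k → ℕ // ∑ i, t i = g ∧ ∀ i, t i ≤ m i} :=
      ⟨fun t => (Finset.sum_le_sum fun i _ => t.2.2 i).not_gt (t.2.1 ▸ hlt)⟩
    rw [Nat.card_of_isEmpty, Nat.choose_eq_zero_of_lt]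
    omega
  · obtain ⟨n, hn⟩ := Nat.exists_eq_add_of_le hge
    have hle : ∀ j, n ≤ m j := fun j => by
      have hfloor : ∀ i, (m i : ℚ) ≤ α i * g := fun i => (hbound _ i).2 le_rfl
      have hrest : ∑ i ∈ Finset.univ.erase j, m i ≤ g := by
        have : ((∑ i ∈ Finset.univ.erase j, m i : ℕ) : ℚ) ≤ g := by
          push_cast
          calc ∑ i ∈ Finset.univ.erase j, (m i : ℚ)
              ≤ ∑ i ∈ Finset.univ.erase j, α i * g := Finset.sum_le_sum fun i _ => hfloor i
            _ = (∑ i ∈ Finset.univ.erase j, α i) * g := (Finset.sum_mul _ _ _).symm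
            _ ≤ g := mul_le_of_le_one_left (Nat.cast_nonneg g) (h1 j)
        exact_mod_cast this
      have := Finset.add_sum_erase Finset.univ m (Finset.mem_univ j)
      omega
    rw [Nat.card_congr (boundedSumEquiv m g n hn.symm hle), card_fun_sum_eq, Fintype.card_fin]
    have htop : (((∑ i, m i : ℕ) : ℤ) - g + k - 1).toNat = n + (k - 1) := by omega
    rw [htop, Nat.choose_symm_add.symm]
    congr 1
    omega
end

section
/- Let [g_1, …, g_k] be an α-communal k-tuple and let g = Σ_i g_i. Then the coordinatewise identity A·[g_1, …, g_k] = Σ_{j=1}^k (m_j·g − n_j·g_j)·x_j holds; that is, for each coordinate i one has A·g_i equal to the i-th entry of Σ_{j=1}^k (m_j·g − n_j·g_j)·x_j, and each coefficient m_j·g − n_j·g_j is a nonnegative integer. -/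
/-- For an α-communal k-tuple `g` with `G = ∑ i, g i`, the
coordinatewise identity `A • g = ∑ j, (m j · G − n j · g j) • x j` holds,
and each coefficient `m j · G − n j · g j` is a nonnegative integer. -/
theorem stmt_6 (k : ℕ) (hk : 2 ≤ k) (α : Fin k → ℚ) (m n : Fin k → ℕ)
    (hm : ∀ i, 0 < m i) (hn : ∀ i, 0 < n i)
    (hcop : ∀ i, Nat.Coprime (m i) (n i))
    (hα : ∀ i, α i = (m i : ℚ) / (n i : ℚ))
    (h1 : ∀ j : Fin k, ∑ i ∈ Finset.univ.erase j, α i ≤ 1)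
    (h2 : 1 < ∑ i, α i)
    (N : ℕ) (hN : N = ∏ i, n i)
    (A : ℚ) (hA : A = (N : ℚ) * ((∑ i, α i) - 1))
    (αhat : Fin k → ℚ)
    (hαhat : ∀ i, αhat i = 1 - ∑ j ∈ Finset.univ.erase i, α j)
    (x : Fin k → Fin k → ℚ)
    (hx : ∀ i j, x i j = ((N : ℚ) / (n i : ℚ)) * (if j = i then αhat i else α j))
    (g : Fin k → ℕ)
    (hg : ∀ i, (g i : ℚ) ≤ α i * ∑ j, g j) :
    (∀ j, n j * g j ≤ m j * ∑ l, g l) ∧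
      ∀ i, A * (g i : ℚ)
        = ∑ j, ((m j : ℚ) * ((∑ l, g l : ℕ) : ℚ) - (n j : ℚ) * (g j : ℚ)) * x j i := by
  have hn0 : ∀ j, (n j : ℚ) ≠ 0 := fun j => by exact_mod_cast (hn j).ne'
  refine ⟨fun j => ?_, fun i => ?_⟩
  · have hj := hg j
    rw [hα, div_mul_eq_mul_div, le_div_iff₀ (by exact_mod_cast hn j)] at hj
    rw [mul_comm (n j)]
    exact_mod_cast hj
  · have hterm : ∀ j, ((m j : ℚ) * ((∑ l, g l : ℕ) : ℚ) - (n j : ℚ) * (g j : ℚ)) * x j i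
        = (N : ℚ) * α i * (α j * ((∑ l, g l : ℕ) : ℚ) - (g j : ℚ))
          + if i = j then
              (N : ℚ) * (1 - ∑ l, α l) * (α j * ((∑ l, g l : ℕ) : ℚ) - (g j : ℚ)) else 0 := by
      intro j
      have hcoef : ((m j : ℚ) * ((∑ l, g l : ℕ) : ℚ) - (n j : ℚ) * (g j : ℚ)) * (N / n j)
          = N * (α j * ((∑ l, g l : ℕ) : ℚ) - (g j : ℚ)) := by
        have := hn0 j
        rw [hα]
        field_simp
      rw [hx, ← mul_assoc, hcoef]
      split_ifs with hij
      · subst hij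
        rw [hαhat, ← Finset.add_sum_erase _ α (Finset.mem_univ i)]
        ring
      · ring
    rw [Finset.sum_congr rfl fun j _ => hterm j, Finset.sum_add_distrib, ← Finset.mul_sum,
      Finset.sum_sub_distrib, ← Finset.sum_mul, Finset.sum_ite_eq, if_pos (Finset.mem_univ i), hA]
    push_cast
    ring
end

section
/- Suppose A = 1. Then every α-communal k-tuple can be written in exactly one way as a nonnegative integer linear combination of the k-tuples x_1, …, x_k; that is, x_1, …, x_k freely generate the monoid of α-communal k-tuples. -/
/-- If `A = 1`, then every α-communal k-tuple can be written in
exactly one way as a nonnegative integer linear combination of the k-tuples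
`x 1, …, x k`. -/
theorem stmt_7 (k : ℕ) (hk : 2 ≤ k) (α : Fin k → ℚ) (m n : Fin k → ℕ)
    (hm : ∀ i, 0 < m i) (hn : ∀ i, 0 < n i)
    (hcop : ∀ i, Nat.Coprime (m i) (n i))
    (hα : ∀ i, α i = (m i : ℚ) / (n i : ℚ))
    (h1 : ∀ j : Fin k, ∑ i ∈ Finset.univ.erase j, α i ≤ 1)
    (h2 : 1 < ∑ i, α i)
    (N : ℕ) (hN : N = ∏ i, n i)
    (hA : (N : ℚ) * ((∑ i, α i) - 1) = 1)
    (αhat : Fin k → ℚ)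
    (hαhat : ∀ i, αhat i = 1 - ∑ j ∈ Finset.univ.erase i, α j)
    (x : Fin k → Fin k → ℚ)
    (hx : ∀ i j, x i j = ((N : ℚ) / (n i : ℚ)) * (if j = i then αhat i else α j))
    (g : Fin k → ℕ)
    (hg : ∀ i, (g i : ℚ) ≤ α i * ∑ j, g j) :
    ∃! c : Fin k → ℕ, ∀ j, (g j : ℚ) = ∑ i, (c i : ℚ) * x i j := by
  have hnq : ∀ i, (n i : ℚ) ≠ 0 := fun i => by exact_mod_cast (hn i).ne'
  have hsum : (N : ℚ) * ∑ i, α i = N + 1 := by linarith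
  have hmn : ∀ i, (n i : ℚ) * α i = m i := fun i => by
    rw [hα i, mul_div_cancel₀ _ (hnq i)]
  have hxδ : ∀ i j, x i j = (N : ℚ) / n i * α j - if j = i then 1 / (n i : ℚ) else 0 := by
    intro i j
    rw [hx]
    split_ifs with h
    · have hhat : αhat i = 1 - (∑ l, α l) + α i := by
        rw [hαhat, ← Finset.add_sum_erase _ _ (Finset.mem_univ i)]
        ring
      subst h
      rw [hhat]
      have := hnq j
      field_simp
      linarith
    · ring
  -- a combination of the `x i` is determined by its total `∑ i, c i * (N / n i)`
  have hcomb : ∀ (c : Fin k → ℕ) (j : Fin k), ∑ i, (c i : ℚ) * x i j =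
      (∑ i, (c i : ℚ) * (N / n i)) * α j - c j / n j := by
    intro c j
    simp only [hxδ, mul_sub, Finset.sum_sub_distrib, Finset.sum_mul, mul_ite, mul_zero,
      Finset.sum_ite_eq, Finset.mem_univ, if_true]
    congr 1
    · exact Finset.sum_congr rfl fun i _ => by ring
    · ring
  have hle : ∀ i, n i * g i ≤ m i * ∑ j, g j := by
    intro i
    have h := mul_le_mul_of_nonneg_left (hg i) (Nat.cast_nonneg (α := ℚ) (n i))
    rw [← mul_assoc, hmn] at h
    exact_mod_cast h
  refine ⟨fun i => m i * ∑ j, g j - n i * g i, fun j => ?_, fun c hc => ?_⟩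
  · have htotal : ∑ i, ((m i * ∑ j, g j - n i * g i : ℕ) : ℚ) * (N / n i) = ∑ j, (g j : ℚ) := by
      have hterm : ∀ i, ((m i * ∑ j, g j - n i * g i : ℕ) : ℚ) * (N / n i) =
          N * α i * (∑ j, (g j : ℚ)) - N * g i := by
        intro i
        rw [Nat.cast_sub (hle i)]
        push_cast
        rw [← hmn]
        have := hnq i
        field_simp
      rw [Finset.sum_congr rfl fun i _ => hterm i, Finset.sum_sub_distrib, ← Finset.sum_mul,
        ← Finset.mul_sum, ← Finset.mul_sum, hsum]
      ring
    rw [hcomb, htotal, Nat.cast_sub (hle j)]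
    push_cast
    rw [← hmn]
    have := hnq j
    field_simp
    ring
  · have hg' : ∀ j, (g j : ℚ) = (∑ i, (c i : ℚ) * (N / n i)) * α j - c j / n j :=
      fun j => (hc j).trans (hcomb c j)
    have htotal : ∑ j, (g j : ℚ) = ∑ i, (c i : ℚ) * (N / n i) := by
      have hdiv : ∑ i, (c i : ℚ) * (N / n i) = N * ∑ i, (c i : ℚ) / n i := by
        rw [Finset.mul_sum]
        exact Finset.sum_congr rfl fun i _ => by ring
      rw [Finset.sum_congr rfl fun j _ => hg' j, Finset.sum_sub_distrib, ← Finset.mul_sum, hdiv]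
      linear_combination (∑ i, (c i : ℚ) / n i) * hsum
    funext j
    rw [eq_comm, Nat.sub_eq_iff_eq_add (hle j)]
    have hj := hg' j
    rw [← htotal] at hj
    have : (m j : ℚ) * ∑ i, (g i : ℚ) = c j + n j * g j := by
      rw [hj, ← hmn]
      have := hnq j
      field_simp
      ring
    exact_mod_cast this
end

section
/- Every α-communal k-tuple [g_1, …, g_k] can be written in a unique way as B(a) + Σ_{i=1}^k c_i·x_i, where a = (a_1, …, a_k) is an element of the set 𝒜 and c_1, …, c_k are nonnegative integers; moreover a_j is the least residue of m_j·g − n_j·g_j modulo A, where g = Σ_i g_i. -/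
open Finset in
/-- The linear system `g j = α j * Y / D - d j / n j`, with `Y = ∑ i, d i / n i` and
`D = ∑ i, α i - 1`, is inverted by `d j = n j * (α j * ∑ i, g i - g j)`. -/
lemma eq_mul_sum_div_sub_iff {ι : Type*} [Fintype ι] {α n d g : ι → ℚ} (hn : ∀ i, n i ≠ 0)
    (hD : ∑ i, α i - 1 ≠ 0) :
    (∀ j, g j = α j * (∑ i, d i / n i) / (∑ i, α i - 1) - d j / n j) ↔
      ∀ j, d j = n j * (α j * ∑ i, g i - g j) := by
  constructor
  · intro h
    have hsum : ∑ i, g i = (∑ i, d i / n i) / (∑ i, α i - 1) := by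
      rw [sum_congr rfl fun j _ => h j, sum_sub_distrib, ← sum_div, ← sum_mul]
      field_simp
      ring
    intro j
    rw [hsum, h j]
    have := hn j
    field_simp
    ring
  · intro h
    have hdiv : ∀ j, d j / n j = α j * ∑ i, g i - g j := fun j => by
      rw [h j, mul_div_cancel_left₀ _ (hn j)]
    have hsum : ∑ i, d i / n i = (∑ i, α i - 1) * ∑ i, g i := by
      rw [sum_congr rfl fun j _ => hdiv j, sum_sub_distrib, ← sum_mul]
      ring
    intro j
    rw [hsum, hdiv j]
    field_simp
    ring

open Finset in
/-- For `i ≠ j`, the denominators `n i` and `n j` jointly divide `∏ l, n l`. -/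
lemma exists_int_prod_div_mul_div {ι : Type*} [Fintype ι] [DecidableEq ι] {n : ι → ℕ}
    (m : ι → ℕ) (hn : ∀ i, 0 < n i) {i j : ι} (hij : j ≠ i) :
    ∃ z : ℤ, ((∏ l, n l : ℕ) : ℚ) / n i * ((m j : ℚ) / n j) = z := by
  obtain ⟨q, hq⟩ : n j ∣ ∏ l ∈ univ.erase i, n l := dvd_prod_of_mem n (by simp [hij])
  refine ⟨q * m j, ?_⟩
  have hi : (n i : ℚ) ≠ 0 := by exact_mod_cast (hn i).ne'
  have hj : (n j : ℚ) ≠ 0 := by exact_mod_cast (hn j).ne'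
  rw [← mul_prod_erase univ n (mem_univ i), hq]
  push_cast
  field_simp

/-- Every α-communal k-tuple `g` can be written in a unique way as
`B(a) + ∑ i, c i • x i` with `a ∈ 𝒜` and `c` a k-tuple of nonnegative
integers; moreover `a j` is the least residue of `m j · g − n j · g j` modulo
`A`, where `g = ∑ i, g i`. -/
theorem stmt_8 (k : ℕ) (hk : 2 ≤ k) (α : Fin k → ℚ) (m n : Fin k → ℕ)
    (hm : ∀ i, 0 < m i) (hn : ∀ i, 0 < n i)
    (hcop : ∀ i, Nat.Coprime (m i) (n i))
    (hα : ∀ i, α i = (m i : ℚ) / (n i : ℚ))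
    (h1 : ∀ j : Fin k, ∑ i ∈ Finset.univ.erase j, α i ≤ 1)
    (h2 : 1 < ∑ i, α i)
    (N : ℕ) (hN : N = ∏ i, n i)
    (A : ℕ) (hA : (A : ℚ) = (N : ℚ) * ((∑ i, α i) - 1))
    (αhat : Fin k → ℚ)
    (hαhat : ∀ i, αhat i = 1 - ∑ j ∈ Finset.univ.erase i, α j)
    (x : Fin k → Fin k → ℚ)
    (hx : ∀ i j, x i j = ((N : ℚ) / (n i : ℚ)) * (if j = i then αhat i else α j))
    (𝒜 : Set (Fin k → ℤ))
    (h𝒜 : ∀ a : Fin k → ℤ, a ∈ 𝒜 ↔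
      (∀ i, 0 ≤ a i ∧ a i < (A : ℤ)) ∧
        ∀ j, ∃ c : ℤ,
          (N : ℚ) * αhat j * ((a j : ℚ) / (n j : ℚ))
            + (N : ℚ) * α j * ∑ i ∈ Finset.univ.erase j, (a i : ℚ) / (n i : ℚ)
          = (A : ℚ) * (c : ℚ))
    (B : (Fin k → ℤ) → Fin k → ℚ)
    (hB : ∀ a j, B a j = (1 / (A : ℚ)) *
      ((N : ℚ) * αhat j * ((a j : ℚ) / (n j : ℚ))
        + (N : ℚ) * α j * ∑ i ∈ Finset.univ.erase j, (a i : ℚ) / (n i : ℚ)))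
    (g : Fin k → ℕ)
    (hg : ∀ i, (g i : ℚ) ≤ α i * ∑ j, g j) :
    (∃! p : (Fin k → ℤ) × (Fin k → ℕ),
        p.1 ∈ 𝒜 ∧ ∀ j, (g j : ℚ) = B p.1 j + ∑ i, (p.2 i : ℚ) * x i j) ∧
      ∀ p : (Fin k → ℤ) × (Fin k → ℕ),
        (p.1 ∈ 𝒜 ∧ ∀ j, (g j : ℚ) = B p.1 j + ∑ i, (p.2 i : ℚ) * x i j) →
          ∀ j, p.1 j
            = ((m j : ℤ) * ((∑ l, g l : ℕ) : ℤ) - (n j : ℤ) * (g j : ℤ)) % (A : ℤ) := by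
  have hn0 : ∀ i, (n i : ℚ) ≠ 0 := fun i => by exact_mod_cast (hn i).ne'
  have hD : (0 : ℚ) < ∑ i, α i - 1 := by linarith
  have hN0 : (0 : ℚ) < N := by
    rw [hN]
    exact_mod_cast Finset.prod_pos fun i _ => hn i
  have hA0 : (0 : ℚ) < A := by
    rw [hA]
    positivity
  have hA0' : (0 : ℤ) < A := by exact_mod_cast hA0
  have hhat : ∀ i, αhat i = α i - (∑ l, α l - 1) := fun i => by
    rw [hαhat, ← Finset.add_sum_erase _ _ (Finset.mem_univ i)]
    ring
  have hB' : ∀ a j, B a j = α j * (∑ i, (a i : ℚ) / n i) / (∑ i, α i - 1) - a j / n j := by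
    intro a j
    rw [hB, hhat, ← Finset.add_sum_erase _ (fun i => (a i : ℚ) / n i) (Finset.mem_univ j), hA]
    field_simp
    ring
  have hx' : ∀ (c : Fin k → ℕ) j, ∑ i, (c i : ℚ) * x i j =
      N * α j * (∑ i, (c i : ℚ) / n i) - A * (c j / n j) := by
    intro c j
    have hterm : ∀ i, (c i : ℚ) * x i j =
        N * α j * ((c i : ℚ) / n i) - if j = i then A * ((c i : ℚ) / n i) else 0 := by
      intro i
      rw [hx]
      split_ifs with h
      · subst h
        rw [hhat, hA]
        ring
      · ring
    simp [hterm, Finset.sum_sub_distrib, Finset.mul_sum]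
  have hrepr : ∀ (a : Fin k → ℤ) (c : Fin k → ℕ),
      (∀ j, (g j : ℚ) = B a j + ∑ i, (c i : ℚ) * x i j) ↔
        ∀ j, a j + (A : ℤ) * c j = (m j : ℤ) * ((∑ l, g l : ℕ) : ℤ) - (n j : ℤ) * (g j : ℤ) := by
    intro a c
    have key := eq_mul_sum_div_sub_iff (α := α) (n := fun i => (n i : ℚ))
      (d := fun i => (a i : ℚ) + A * c i) (g := fun i => (g i : ℚ)) hn0 hD.ne'
    refine (forall_congr' fun j => ?_).trans (key.trans (forall_congr' fun j => ?_))
    · have : B a j + ∑ i, (c i : ℚ) * x i j =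
          α j * (∑ i, ((a i : ℚ) + A * c i) / n i) / (∑ i, α i - 1) -
            ((a j : ℚ) + A * c j) / n j := by
        simp only [hB', hx', add_div, Finset.sum_add_distrib, mul_div_assoc, ← Finset.mul_sum]
        rw [hA]
        field_simp
        ring
      rw [this]
    · have : (n j : ℚ) * (α j * ∑ i, (g i : ℚ) - g j) = m j * ∑ i, (g i : ℚ) - n j * g j := by
        rw [hα, mul_sub, ← mul_assoc, mul_div_cancel₀ _ (hn0 j)]
      rw [this, ← @Int.cast_inj ℚ]
      push_cast
      rfl
  have hxint : ∀ i j, ∃ z : ℤ, x i j = z := by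
    intro i j
    have hoff : ∀ l, l ≠ i → ∃ z : ℤ, (N : ℚ) / n i * α l = z := fun l hl => by
      rw [hN, hα]
      exact exists_int_prod_div_mul_div m hn hl
    rw [hx]
    split_ifs with h
    · choose! z hz using hoff
      refine ⟨(∏ l ∈ Finset.univ.erase i, n l : ℕ) - ∑ l ∈ Finset.univ.erase i, z l, ?_⟩
      rw [hαhat, mul_sub, Finset.mul_sum,
        Finset.sum_congr rfl fun l hl => hz l (Finset.ne_of_mem_erase hl), mul_one, hN,
        ← Finset.mul_prod_erase Finset.univ n (Finset.mem_univ i)]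
      push_cast
      rw [mul_div_cancel_left₀ _ (hn0 i)]
    · exact hoff j h
  have hmod : ∀ p : (Fin k → ℤ) × (Fin k → ℕ),
      (p.1 ∈ 𝒜 ∧ ∀ j, (g j : ℚ) = B p.1 j + ∑ i, (p.2 i : ℚ) * x i j) →
        ∀ j, p.1 j
          = ((m j : ℤ) * ((∑ l, g l : ℕ) : ℤ) - (n j : ℤ) * (g j : ℤ)) % (A : ℤ) := by
    rintro ⟨a, c⟩ ⟨ha, hac⟩ j
    obtain ⟨h0, hlt⟩ := ((h𝒜 a).1 ha).1 j
    rw [← (hrepr a c).1 hac j, Int.add_mul_emod_self_left, Int.emod_eq_of_lt h0 hlt]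
  refine ⟨?_, hmod⟩
  set d : Fin k → ℤ := fun j => (m j : ℤ) * ((∑ l, g l : ℕ) : ℤ) - (n j : ℤ) * (g j : ℤ) with hd
  have hd0 : ∀ j, 0 ≤ d j := by
    intro j
    have h := hg j
    rw [hα, div_mul_eq_mul_div, le_div_iff₀ (by exact_mod_cast hn j)] at h
    have h' : (g j : ℤ) * n j ≤ m j * ((∑ l, g l : ℕ) : ℤ) := by exact_mod_cast h
    simp only [hd]
    linarith
  have hsol : ∀ j, (g j : ℚ) = B (fun j => d j % A) j +
      ∑ i, (((d i / A).toNat : ℕ) : ℚ) * x i j := by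
    refine (hrepr _ (fun i => (d i / A).toNat)).2 fun j => ?_
    rw [Int.toNat_of_nonneg (Int.ediv_nonneg (hd0 j) hA0'.le)]
    exact Int.emod_add_mul_ediv _ _
  refine ⟨(fun j => d j % A, fun j => (d j / A).toNat), ⟨(h𝒜 _).2 ⟨fun i =>
    ⟨Int.emod_nonneg _ hA0'.ne', Int.emod_lt_of_pos _ hA0'⟩, fun j => ?_⟩, hsol⟩, ?_⟩
  · choose z hz using hxint
    refine ⟨g j - ∑ i, ((d i / A).toNat : ℤ) * z i j, ?_⟩
    have h := hsol j
    rw [hB, ← sub_eq_iff_eq_add, one_div, eq_inv_mul_iff_mul_eq₀ hA0.ne'] at h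
    rw [← h]
    push_cast
    simp only [hz]
  · rintro ⟨a, c⟩ hac
    have ha : a = fun j => d j % A := funext (hmod _ hac)
    have hc : c = fun j => (d j / A).toNat := by
      funext j
      have h1 := (hrepr a c).1 hac.2 j
      have h2 : a j = d j % A := congrFun ha j
      have h3 := Int.emod_add_mul_ediv (d j) A
      have h4 : (c j : ℤ) = d j / A := by
        refine mul_left_cancel₀ hA0'.ne' ?_
        simp only [hd] at h2 h3 ⊢
        linarith
      rw [← h4, Int.toNat_natCast]
    rw [ha, hc]
end

section
/- The generating function F(x) = Σ_{g=0}^∞ f(g)·x^g satisfies the formal power series identity F(x)·Π_{i=1}^k (1 − x^{N/n_i}) = Σ_{a ∈ 𝒜} x^{b(a)}. -/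
open PowerSeries in
/-- Multiplying the generating function of the points of `P`, graded by `wt`, by `1 - X ^ w i` for
`i ∈ T` keeps the points whose coordinates in `T` are less than `A`, provided translation by `A`
in direction `i` preserves `P` and raises the weight by `w i`. -/
theorem PowerSeries.mk_card_mul_prod_one_sub_X_pow {ι : Type*} [DecidableEq ι]
    (P : (ι → ℕ) → Prop) (wt : (ι → ℕ) → ℚ) (w : ι → ℕ) (A : ℕ)
    (hnonneg : ∀ d, 0 ≤ wt d)
    (hwt : ∀ d i, wt (d + Pi.single i A) = wt d + w i)
    (hP : ∀ d i, P (d + Pi.single i A) ↔ P d)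
    (hfin : ∀ g : ℕ, {d | wt d = g}.Finite) (T : Finset ι) :
    (PowerSeries.mk fun g : ℕ => (Set.ncard {d | P d ∧ wt d = g} : ℚ)) *
        ∏ i ∈ T, (1 - PowerSeries.X ^ w i) =
      PowerSeries.mk fun g : ℕ =>
        (Set.ncard {d | (P d ∧ wt d = g) ∧ ∀ i ∈ T, d i < A} : ℚ) := by
  induction T using Finset.induction_on with
  | empty => simp
  | insert i T hi ih =>
    rw [Finset.prod_insert hi, mul_left_comm, ih, mul_comm, mul_sub, mul_one]
    ext g
    simp only [map_sub, coeff_mk, coeff_mul_X_pow']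
    have hsplit : {d | (P d ∧ wt d = g) ∧ ∀ i ∈ T, d i < A} =
        {d | (P d ∧ wt d = g) ∧ ∀ j ∈ insert i T, d j < A} ∪
          {d | ((P d ∧ wt d = g) ∧ ∀ i ∈ T, d i < A) ∧ A ≤ d i} := by
      ext d
      simp only [Set.mem_ofPred_eq, Set.mem_union, Finset.forall_mem_insert]
      have := lt_or_ge (d i) A
      tauto
    have hdisj : Disjoint {d | (P d ∧ wt d = g) ∧ ∀ j ∈ insert i T, d j < A}
        {d | ((P d ∧ wt d = g) ∧ ∀ i ∈ T, d i < A) ∧ A ≤ d i} := by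
      rw [Set.disjoint_left]
      intro d hd hd'
      exact absurd (hd.2 i (Finset.mem_insert_self i T)) (not_lt.mpr hd'.2)
    have hcard := Set.ncard_union_eq hdisj
      ((hfin g).subset fun d hd => hd.1.2) ((hfin g).subset fun d hd => hd.1.1.2)
    rw [← hsplit] at hcard
    have hcancel (d : ι → ℕ) (hd : A ≤ d i) : (d - Pi.single i A) + Pi.single i A = d := by
      refine tsub_add_cancel_of_le fun j => ?_
      by_cases hj : j = i
      · subst hj; simpa using hd
      · simp [hj]
    have hshift : Set.ncard {d | ((P d ∧ wt d = g) ∧ ∀ i ∈ T, d i < A) ∧ A ≤ d i} =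
        if w i ≤ g then
          Set.ncard {d | (P d ∧ wt d = (g - w i : ℕ)) ∧ ∀ i ∈ T, d i < A} else 0 := by
      split_ifs with hg
      · have himage : {d | ((P d ∧ wt d = g) ∧ ∀ i ∈ T, d i < A) ∧ A ≤ d i} =
            (fun d => d + Pi.single i A) ''
              {d | (P d ∧ wt d = (g - w i : ℕ)) ∧ ∀ i ∈ T, d i < A} := by
          have hT (d : ι → ℕ) :
              (∀ j ∈ T, (d + Pi.single i A : ι → ℕ) j < A) ↔ ∀ j ∈ T, d j < A := by
            refine forall₂_congr fun j hj => ?_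
            have : j ≠ i := fun h => hi (h ▸ hj)
            simp [this]
          ext d
          simp only [Set.mem_ofPred_eq, Set.mem_image]
          constructor
          · rintro ⟨⟨⟨hPd, hwd⟩, hTd⟩, hAd⟩
            refine ⟨d - Pi.single i A, ⟨⟨?_, ?_⟩, ?_⟩, hcancel d hAd⟩
            · rwa [← hP _ i, hcancel d hAd]
            · have := hwt (d - Pi.single i A) i
              rw [hcancel d hAd] at this
              push_cast [hg]
              linarith
            · rwa [← hT, hcancel d hAd]
          · rintro ⟨d, ⟨⟨hPd, hwd⟩, hTd⟩, rfl⟩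
            refine ⟨⟨⟨(hP d i).2 hPd, ?_⟩, (hT d).2 hTd⟩, by simp⟩
            rw [hwt, hwd]
            push_cast [hg]
            ring
        rw [himage, Set.ncard_image_of_injective _ (add_left_injective _)]
      · rw [Set.ncard_eq_zero ((hfin g).subset fun d hd => hd.1.1.2),
          Set.eq_empty_iff_forall_notMem]
        rintro d ⟨⟨⟨-, hwd⟩, -⟩, hAd⟩
        have h := hwt (d - Pi.single i A) i
        rw [hcancel d hAd, hwd] at h
        have h0 := hnonneg (d - Pi.single i A)
        exact hg (by exact_mod_cast (by linarith : (w i : ℚ) ≤ g))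
    rw [hcard, hshift]
    split_ifs <;> simp

/-- For `i ≠ j` the rational `m j / n j * ((∏ l, n l) / n i)` is an integer. -/
theorem exists_int_mul_prod_div {ι : Type*} [Fintype ι] [DecidableEq ι] (m n : ι → ℕ)
    (hn : ∀ i, 0 < n i) {i j : ι} (hij : i ≠ j) :
    ∃ c : ℤ, (m j : ℚ) / n j * (((∏ l, n l : ℕ) : ℚ) / n i) = c := by
  refine ⟨m j * ∏ l ∈ (Finset.univ.erase i).erase j, (n l : ℤ), ?_⟩
  have hi : (n i : ℚ) ≠ 0 := by exact_mod_cast (hn i).ne'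
  have hj : (n j : ℚ) ≠ 0 := by exact_mod_cast (hn j).ne'
  rw [← Finset.mul_prod_erase Finset.univ n (Finset.mem_univ i),
    ← Finset.mul_prod_erase (Finset.univ.erase i) n
      (Finset.mem_erase.2 ⟨hij.symm, Finset.mem_univ j⟩)]
  push_cast
  field_simp

/-- The generating function `F(x) = ∑ g, f(g)·x^g` satisfies
`F(x) · ∏ i, (1 − x^(N / n i)) = ∑ a ∈ 𝒜, x^(b a)` as formal power series
over ℚ. Here `S` is the (finite) set `𝒜` and `b a` is the nonnegative integer
equal to `(N/A) · ∑ i, a i / n i`. -/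
theorem stmt_10 (k : ℕ) (hk : 2 ≤ k) (α : Fin k → ℚ) (m n : Fin k → ℕ)
    (hm : ∀ i, 0 < m i) (hn : ∀ i, 0 < n i)
    (hcop : ∀ i, Nat.Coprime (m i) (n i))
    (hα : ∀ i, α i = (m i : ℚ) / (n i : ℚ))
    (h1 : ∀ j : Fin k, ∑ i ∈ Finset.univ.erase j, α i ≤ 1)
    (h2 : 1 < ∑ i, α i)
    (N : ℕ) (hN : N = ∏ i, n i)
    (A : ℕ) (hA : (A : ℚ) = (N : ℚ) * ((∑ i, α i) - 1))
    (αhat : Fin k → ℚ)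
    (hαhat : ∀ i, αhat i = 1 - ∑ j ∈ Finset.univ.erase i, α j)
    (f : ℕ → ℕ)
    (hf : ∀ g : ℕ, f g = Nat.card
      {t : Fin k → ℕ // (∑ i, t i) = g ∧ ∀ i, (t i : ℚ) ≤ α i * (g : ℚ)})
    (S : Finset (Fin k → ℕ))
    (hS : ∀ a : Fin k → ℕ, a ∈ S ↔
      (∀ i, a i < A) ∧
        ∀ j, ∃ c : ℤ,
          (N : ℚ) * αhat j * ((a j : ℚ) / (n j : ℚ))
            + (N : ℚ) * α j * ∑ i ∈ Finset.univ.erase j, (a i : ℚ) / (n i : ℚ)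
          = (A : ℚ) * (c : ℚ))
    (b : (Fin k → ℕ) → ℕ)
    (hb : ∀ a ∈ S, (b a : ℚ) = ((N : ℚ) / (A : ℚ)) * ∑ i, (a i : ℚ) / (n i : ℚ)) :
    (PowerSeries.mk fun g => (f g : ℚ)) * ∏ i, (1 - PowerSeries.X ^ (N / n i))
      = ∑ a ∈ S, PowerSeries.X ^ (b a) := by
  classical
  have hn0 (i) : (n i : ℚ) ≠ 0 := by exact_mod_cast (hn i).ne'
  have hnpos (i) : (0 : ℚ) < n i := by exact_mod_cast hn i
  have hNpos : (0 : ℚ) < N := by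
    rw [hN]
    exact_mod_cast Finset.prod_pos fun i _ => hn i
  have hApos : (0 : ℚ) < A := by
    rw [hA]
    exact mul_pos hNpos (by linarith)
  have hA0 := hApos.ne'
  have hN0 := hNpos.ne'
  have hw (i) : ((N / n i : ℕ) : ℚ) = N / n i :=
    Nat.cast_div (hN ▸ Finset.dvd_prod_of_mem n (Finset.mem_univ i)) (hn0 i)
  set wt : (Fin k → ℕ) → ℚ := fun d => (N : ℚ) / A * ∑ i, (d i : ℚ) / n i with hwt_def
  set P : (Fin k → ℕ) → Prop := fun d => ∀ j, ∃ c : ℤ, α j * wt d - d j / n j = c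
  have hwt (d : Fin k → ℕ) (i : Fin k) :
      wt (d + Pi.single i A) = wt d + ((N / n i : ℕ) : ℚ) := by
    have hsum : ∑ j, ((Pi.single i A : Fin k → ℕ) j : ℚ) / n j = A / n i := by
      rw [Finset.sum_eq_single i]
      · simp
      · intro j _ hj
        simp [hj]
      · simp
    simp only [hwt_def, Pi.add_apply, Nat.cast_add, add_div, Finset.sum_add_distrib, mul_add,
      hsum, hw]
    field_simp
  -- The generators of the cone are integral.
  have hgen (i j : Fin k) :
      ∃ c : ℤ, α j * (N / n i) - ((Pi.single i A : Fin k → ℕ) j : ℚ) / n j = c := by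
    by_cases hij : i = j
    · subst hij
      choose! c hc using fun (j : Fin k) (hj : i ≠ j) => exists_int_mul_prod_div m n hn hj
      refine ⟨(N / n i : ℕ) - ∑ j ∈ Finset.univ.erase i, c j, ?_⟩
      have hsum : ((∑ j ∈ Finset.univ.erase i, c j : ℤ) : ℚ) =
          (∑ j ∈ Finset.univ.erase i, α j) * (N / n i) := by
        rw [Int.cast_sum, Finset.sum_mul]
        refine Finset.sum_congr rfl fun j hj => ?_
        rw [hα, hN, hc j (Finset.ne_of_mem_erase hj).symm]
      rw [Int.cast_sub, hsum, Int.cast_natCast, hw, Pi.single_eq_same, hA,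
        ← Finset.add_sum_erase _ _ (Finset.mem_univ i)]
      ring
    · obtain ⟨c, hc⟩ := exists_int_mul_prod_div m n hn hij
      refine ⟨c, ?_⟩
      rw [← hc, hα, hN]
      simp [Ne.symm hij]
  have hP (d : Fin k → ℕ) (i : Fin k) : P (d + Pi.single i A) ↔ P d := by
    refine forall_congr' fun j => ?_
    obtain ⟨e, he⟩ := hgen i j
    have heq : α j * wt (d + Pi.single i A) - ((d + Pi.single i A : Fin k → ℕ) j : ℚ) / n j =
        (α j * wt d - d j / n j) + e := by
      rw [← he, hwt, hw, Pi.add_apply]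
      push_cast
      ring
    rw [heq]
    constructor
    · rintro ⟨c, hc⟩
      exact ⟨c - e, by push_cast; linarith⟩
    · rintro ⟨c, hc⟩
      exact ⟨c + e, by push_cast; linarith⟩
  have hnonneg (d) : 0 ≤ wt d := by positivity
  have hsum (d : Fin k → ℕ) : ∑ i, (d i : ℚ) / n i = ((∑ i, α i) - 1) * wt d := by
    simp only [hwt_def]
    have : (∑ i, α i) - 1 = A / N := by
      rw [hA]
      field_simp
    rw [this]
    field_simp
  have hfin (g : ℕ) : {d | wt d = g}.Finite := by
    refine (Set.finite_Iic fun i => ⌊((∑ i, α i) - 1) * g * n i⌋₊).subset fun d hd i => ?_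
    refine Nat.le_floor ?_
    rw [← div_le_iff₀ (hnpos i), ← show wt d = g from hd, ← hsum]
    exact Finset.single_le_sum (f := fun i => (d i : ℚ) / n i) (fun j _ => by positivity)
      (Finset.mem_univ i)
  have hcard (g : ℕ) : f g = Set.ncard {d | P d ∧ wt d = g} := by
    rw [hf, ← Nat.card_coe_set_eq]
    have hle (t : Fin k → ℕ) (ht : ∀ i, (t i : ℚ) ≤ α i * g) (i : Fin k) :
        n i * t i ≤ m i * g := by
      have h := ht i
      rw [hα, div_mul_eq_mul_div, le_div_iff₀ (hnpos i)] at h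
      rw [mul_comm]
      exact_mod_cast h
    have hdiv (t : Fin k → ℕ) (ht : ∀ i, (t i : ℚ) ≤ α i * g) (i : Fin k) :
        ((m i * g - n i * t i : ℕ) : ℚ) / n i = α i * g - t i := by
      rw [Nat.cast_sub (hle t ht i), hα]
      push_cast
      field_simp [hn0 i]
    have hwtd (t : Fin k → ℕ) (hts : ∑ i, t i = g) (ht : ∀ i, (t i : ℚ) ≤ α i * g) :
        wt (fun i => m i * g - n i * t i) = g := by
      have hts' : ∑ i, (t i : ℚ) = g := by exact_mod_cast hts
      simp only [hwt_def, hdiv t ht, Finset.sum_sub_distrib, ← Finset.sum_mul, hts']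
      rw [div_mul_eq_mul_div, div_eq_iff hA0, hA]
      ring
    refine Nat.card_eq_of_bijective (fun t => ⟨fun i => m i * g - n i * t.1 i,
      fun j => ⟨t.1 j, ?_⟩, hwtd t.1 t.2.1 t.2.2⟩) ⟨?_, ?_⟩
    · rw [hwtd t.1 t.2.1 t.2.2, hdiv t.1 t.2.2]
      push_cast
      ring
    · rintro ⟨t, hts, ht⟩ ⟨u, hus, hu⟩ h
      refine Subtype.ext (funext fun i => ?_)
      have hi : m i * g - n i * t i = m i * g - n i * u i := congrFun (Subtype.ext_iff.1 h) i
      have h3 := hdiv t ht i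
      rw [hi, hdiv u hu i] at h3
      exact_mod_cast (by linarith : (t i : ℚ) = u i)
    · rintro ⟨d, hPd, hwd⟩
      have hPd_int := hPd
      choose c hc using hPd_int
      rw [hwd] at hc
      have hcle (i) : (c i : ℚ) ≤ α i * g := by
        rw [← hc]
        linarith [show (0 : ℚ) ≤ d i / n i by positivity]
      have hcsum : ∑ i, (c i : ℚ) = g := by
        simp only [← hc, Finset.sum_sub_distrib, ← Finset.sum_mul, hsum, hwd]
        ring
      have hc0 (i) : 0 ≤ c i := by
        have h3 : ∑ j ∈ Finset.univ.erase i, (c j : ℚ) ≤ g := by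
          calc ∑ j ∈ Finset.univ.erase i, (c j : ℚ)
              ≤ (∑ j ∈ Finset.univ.erase i, α j) * g := by
                rw [Finset.sum_mul]
                exact Finset.sum_le_sum fun j _ => hcle j
            _ ≤ 1 * g := by gcongr; exact h1 i
            _ = g := one_mul _
        rw [← Finset.add_sum_erase _ _ (Finset.mem_univ i)] at hcsum
        exact_mod_cast (by linarith : (0 : ℚ) ≤ c i)
      lift c to Fin k → ℕ using hc0
      simp only [Int.cast_natCast] at hc hcle hcsum
      refine ⟨⟨c, by exact_mod_cast hcsum, hcle⟩, Subtype.ext (funext fun i => ?_)⟩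
      have h3 := hdiv c hcle i
      rw [← hc i, sub_sub_cancel] at h3
      exact_mod_cast (div_left_inj' (hn0 i)).1 h3
  have hSP (a : Fin k → ℕ) : a ∈ S ↔ (∀ i, a i < A) ∧ P a := by
    rw [hS]
    refine and_congr_right fun _ => forall_congr' fun j => exists_congr fun c => ?_
    have heq : (N : ℚ) * αhat j * ((a j : ℚ) / (n j : ℚ))
        + (N : ℚ) * α j * ∑ i ∈ Finset.univ.erase j, (a i : ℚ) / (n i : ℚ) =
        A * (α j * wt a - a j / n j) := by
      have hAwt : A * wt a = N * ∑ i, (a i : ℚ) / n i := by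
        simp only [hwt_def]
        field_simp
      have h3 : (A : ℚ) * (α j * wt a - a j / n j) = α j * (A * wt a) - A * (a j / n j) := by
        ring
      rw [h3, hAwt, hA, hαhat, ← Finset.add_sum_erase _ α (Finset.mem_univ j),
        ← Finset.add_sum_erase _ (fun i => (a i : ℚ) / n i) (Finset.mem_univ j)]
      ring
    rw [heq, mul_right_inj' hA0]
  simp only [hcard]
  rw [PowerSeries.mk_card_mul_prod_one_sub_X_pow P wt (fun i => N / n i) A hnonneg hwt hP hfin]
  ext g
  rw [PowerSeries.coeff_mk, map_sum]
  simp only [PowerSeries.coeff_X_pow, Finset.sum_boole]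
  rw [← Set.ncard_coe_finset]
  congr 2
  ext d
  simp only [Set.mem_ofPred_eq, Finset.coe_filter, hSP, Finset.mem_univ, true_imp_iff]
  constructor
  · rintro ⟨⟨hPd, hwd⟩, hd⟩
    refine ⟨⟨hd, hPd⟩, ?_⟩
    have h3 := hb d ((hSP d).2 ⟨hd, hPd⟩)
    exact_mod_cast hwd.symm.trans h3.symm
  · rintro ⟨⟨hd, hPd⟩, rfl⟩
    exact ⟨⟨hPd, (hb d ((hSP d).2 ⟨hd, hPd⟩)).symm⟩, hd⟩
end

section
/- Let α_1 = 1/2, α_2 = 1/3, α_3 = 1/5. Then every α-communal triple of nonnegative integers can be written in exactly one way as a nonnegative integer linear combination of the triples [7,5,3], [5,3,2], and [3,2,1]. -/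
/-- For `α = (1/2, 1/3, 1/5)`, every α-communal triple of
nonnegative integers can be written in exactly one way as a nonnegative
integer linear combination of `[7,5,3]`, `[5,3,2]`, `[3,2,1]`. -/
theorem stmt_11 (g : Fin 3 → ℕ)
    (hg : ∀ i, (g i : ℚ) ≤ ![(1 : ℚ)/2, 1/3, 1/5] i * ∑ j, g j) :
    ∃! c : Fin 3 → ℕ, ∀ j,
      g j = c 0 * ![7, 5, 3] j + c 1 * ![5, 3, 2] j + c 2 * ![3, 2, 1] j := by
  simp only [Fin.forall_fin_succ, Fin.sum_univ_three] at hg ⊢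
  simp at hg ⊢
  obtain ⟨h0, h1, h2⟩ := hg
  have hx : g 0 ≤ g 1 + g 2 := by
    have : (g 0 : ℚ) ≤ g 1 + g 2 := by linarith
    exact_mod_cast this
  have hy : 2 * g 1 ≤ g 0 + g 2 := by
    have : 2 * (g 1 : ℚ) ≤ g 0 + g 2 := by linarith
    exact_mod_cast this
  have hz : 4 * g 2 ≤ g 0 + g 1 := by
    have : 4 * (g 2 : ℚ) ≤ g 0 + g 1 := by linarith
    exact_mod_cast this
  refine ⟨![g 1 + g 2 - g 0, g 0 + g 2 - 2 * g 1, g 0 + g 1 - 4 * g 2], ?_, ?_⟩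
  · simp only [Matrix.cons_val]
    omega
  · rintro c ⟨e0, e1, e2⟩
    ext i
    fin_cases i <;> simp <;> omega
end

section
/- Let α_1 = 1/2, α_2 = 1/3, α_3 = 1/5, and let f(g) be the number of α-communal compositions of g. Then the generating function satisfies the formal power series identity Σ_{g=0}^∞ f(g)·x^g · (1 − x^{15})(1 − x^{10})(1 − x^{6}) = 1. -/
open PowerSeries Finset

/-- The geometric series `∑ X ^ (d * k)` is inverse to `1 - X ^ d`. -/
theorem PowerSeries.mk_ite_dvd_mul_one_sub_X_pow {R : Type*} [CommRing R] {d : ℕ} (hd : 0 < d) :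
    (PowerSeries.mk fun n => if d ∣ n then (1 : R) else 0) * (1 - X ^ d) = 1 := by
  ext n
  rw [mul_sub, mul_one, map_sub, coeff_mk, coeff_mul_X_pow', coeff_mk, coeff_one]
  rcases Nat.eq_zero_or_pos n with rfl | hn
  · simp [hd.ne']
  · by_cases h : d ≤ n
    · simp [h, hn.ne', (Nat.dvd_sub_iff_left h dvd_rfl)]
    · simp [h, hn.ne', Nat.not_dvd_of_pos_of_lt hn (not_le.mp h)]

/-- The slack variables `u = g - 2a`, `v = g - 3b`, `w = g - 5c` put the communal compositions
`(a, b, c)` of `g` in bijection with the decompositions `g = 15u + 10v + 6w`. -/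
theorem card_communal_eq_card_filter (g : ℕ) :
    Nat.card {t : Fin 3 → ℕ // (∑ i, t i) = g ∧
        ∀ i, (t i : ℚ) ≤ ![(1 : ℚ)/2, 1/3, 1/5] i * (g : ℚ)} =
      #{s ∈ (antidiagonal g).sigma fun p => antidiagonal p.1 |
        15 ∣ s.2.1 ∧ 10 ∣ s.2.2 ∧ 6 ∣ s.1.2} := by
  have communal_iff (t : Fin 3 → ℕ) : ((∑ i, t i) = g ∧
      ∀ i, (t i : ℚ) ≤ ![(1 : ℚ)/2, 1/3, 1/5] i * (g : ℚ)) ↔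
      t 0 + t 1 + t 2 = g ∧ 2 * t 0 ≤ g ∧ 3 * t 1 ≤ g ∧ 5 * t 2 ≤ g := by
    simp only [Fin.sum_univ_three, Fin.forall_fin_succ]
    simp only [← @Nat.cast_le ℚ]
    push_cast
    simp
    intro _
    refine and_congr ?_ (and_congr ?_ ?_) <;> constructor <;> intro h <;> linarith
  simp only [communal_iff]
  rw [← Nat.card_eq_finsetCard]
  refine Nat.card_congr
    { toFun := fun t => ⟨⟨(15 * (g - 2 * t.1 0) + 10 * (g - 3 * t.1 1), 6 * (g - 5 * t.1 2)),
        (15 * (g - 2 * t.1 0), 10 * (g - 3 * t.1 1))⟩, ?_⟩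
      invFun := fun s => ⟨![(g - s.1.2.1 / 15) / 2, (g - s.1.2.2 / 10) / 3,
        (g - s.1.1.2 / 6) / 5], ?_⟩
      left_inv := ?_
      right_inv := ?_ }
  · obtain ⟨t, ht⟩ := t
    simp only [mem_filter, mem_sigma, HasAntidiagonal.mem_antidiagonal, dvd_mul_right, and_true]
    omega
  · obtain ⟨⟨⟨p, w⟩, u, v⟩, hs⟩ := s
    simp only [mem_filter, mem_sigma, HasAntidiagonal.mem_antidiagonal] at hs
    simp only [Matrix.cons_val]
    omega
  · rintro ⟨t, ht⟩
    ext i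
    fin_cases i <;> simp <;> omega
  · rintro ⟨⟨⟨p, w⟩, u, v⟩, hs⟩
    simp only [mem_filter, mem_sigma, HasAntidiagonal.mem_antidiagonal] at hs
    obtain ⟨⟨h, h'⟩, ⟨u, rfl⟩, ⟨v, rfl⟩, ⟨w, rfl⟩⟩ := hs
    subst h'
    have hu : 15 * (g - 2 * ((g - 15 * u / 15) / 2)) = 15 * u := by omega
    have hv : 10 * (g - 3 * ((g - 10 * v / 10) / 3)) = 10 * v := by omega
    have hw : 6 * (g - 5 * ((g - 6 * w / 6) / 5)) = 6 * w := by omega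
    simp only [Matrix.cons_val, hu, hv, hw]

/-- For `α = (1/2, 1/3, 1/5)` and `f g` the number of α-communal
compositions of `g`, one has `(∑ g, f(g)·x^g)·(1−x^15)(1−x^10)(1−x^6) = 1`
as formal power series over ℚ. -/
theorem stmt_12 (f : ℕ → ℕ)
    (hf : ∀ g : ℕ, f g = Nat.card
      {t : Fin 3 → ℕ // (∑ i, t i) = g ∧
        ∀ i, (t i : ℚ) ≤ ![(1 : ℚ)/2, 1/3, 1/5] i * (g : ℚ)}) :
    (PowerSeries.mk fun g => (f g : ℚ)) *
        ((1 - PowerSeries.X ^ 15) * (1 - PowerSeries.X ^ 10) *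
          (1 - PowerSeries.X ^ 6))
      = 1 := by
  have key : (PowerSeries.mk fun g => (f g : ℚ)) =
      (PowerSeries.mk fun n => if 15 ∣ n then (1 : ℚ) else 0) *
      (PowerSeries.mk fun n => if 10 ∣ n then (1 : ℚ) else 0) *
      (PowerSeries.mk fun n => if 6 ∣ n then (1 : ℚ) else 0) := by
    ext g
    simp only [coeff_mul, coeff_mk, sum_mul]
    rw [hf, card_communal_eq_card_filter, card_filter, Nat.cast_sum, sum_sigma]
    refine sum_congr rfl fun p _ => sum_congr rfl fun q _ => ?_
    simp only [← ite_and, and_assoc, ite_mul, one_mul, zero_mul, Nat.cast_ite, Nat.cast_one, Nat.cast_zero]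
  rw [key]
  calc _ = ((PowerSeries.mk fun n => if 15 ∣ n then (1 : ℚ) else 0) * (1 - X ^ 15)) *
      ((PowerSeries.mk fun n => if 10 ∣ n then (1 : ℚ) else 0) * (1 - X ^ 10)) *
      ((PowerSeries.mk fun n => if 6 ∣ n then (1 : ℚ) else 0) * (1 - X ^ 6)) := by ring
    _ = 1 := by simp only [mk_ite_dvd_mul_one_sub_X_pow, Nat.ofNat_pos, mul_one]
end

section
/- Fix an integer k ≥ 2, set α_i = 1/(k−1) for 1 ≤ i ≤ k, and let f(g) be the number of α-communal compositions of g. If ℓ is the least residue of g modulo k−1 (so 0 ≤ ℓ ≤ k−2 and g ≡ ℓ mod k−1), then f(g) = C((g − ℓ·k)/(k−1) + k − 1, k − 1), where C(n, r) denotes the binomial coefficient (interpreted as 0 when g − ℓ·k < −(k−1)²+... i.e. when the top argument is negative). -/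
/-- Stars and bars for functions `Fin k → ℕ` with prescribed sum. -/
theorem card_fin_fun_sum_eq (k n : ℕ) (hk : 1 ≤ k) :
    Nat.card {t : Fin k → ℕ // ∑ i, t i = n} = (n + (k - 1)).choose (k - 1) := by
  rw [← Nat.card_congr (Sym.equivNatSumOfFintype (Fin k) n), Nat.card_eq_fintype_card,
    Sym.card_sym_eq_choose, Fintype.card_fin, show k + n - 1 = n + (k - 1) by omega,
    Nat.choose_symm_add]

theorem sum_reflect_add_sum {k q : ℕ} (t : Fin k → ℕ) (hb : ∀ i, t i ≤ q) :
    ∑ i, (q - t i) + ∑ i, t i = k * q := by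
  rw [← Finset.sum_add_distrib, Finset.sum_congr rfl fun i _ => Nat.sub_add_cancel (hb i)]
  simp

/-- Reflecting every part `t i ↦ q - t i` preserves the bound `t i ≤ q` and turns the total
`g` into `n`, where `g + n = k * q`. -/
def boundedSumReflectEquiv (k q g n : ℕ) (h : g + n = k * q) (hn : n ≤ q) :
    {t : Fin k → ℕ // ∑ i, t i = g ∧ ∀ i, t i ≤ q} ≃ {t : Fin k → ℕ // ∑ i, t i = n} where
  toFun t := ⟨fun i => q - t.1 i, by
    obtain ⟨t, ht, hb⟩ := t
    have hs := sum_reflect_add_sum t hb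
    dsimp only
    omega⟩
  invFun t := ⟨fun i => q - t.1 i, by
    obtain ⟨t, ht⟩ := t
    have hb (i) : t i ≤ q :=
      (Finset.single_le_sum (fun _ _ => Nat.zero_le _) (Finset.mem_univ i)).trans (ht.trans_le hn)
    have hs := sum_reflect_add_sum t hb
    dsimp only
    exact ⟨by omega, fun i => Nat.sub_le _ _⟩⟩
  left_inv t := Subtype.ext <| funext fun i => Nat.sub_sub_self (t.2.2 i)
  right_inv t := Subtype.ext <| funext fun i => Nat.sub_sub_self <|
    (Finset.single_le_sum (fun _ _ => Nat.zero_le _) (Finset.mem_univ i)).trans (t.2.trans_le hn)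


/-- For `α i = 1/(k−1)` and `ℓ = g % (k−1)`, the number of
α-communal compositions of `g` is `C((g − ℓ·k)/(k−1) + k − 1, k − 1)`
(interpreted as 0 when the top argument is negative, via `Int.toNat`). -/
theorem stmt_13 (k : ℕ) (hk : 2 ≤ k) (f : ℕ → ℕ)
    (hf : ∀ g : ℕ, f g = Nat.card
      {t : Fin k → ℕ // (∑ i, t i) = g ∧
        ∀ i, (t i : ℚ) ≤ (g : ℚ) / ((k : ℚ) - 1)})
    (g : ℕ) :
    f g = ((((g : ℤ) - (g % (k - 1) : ℕ) * (k : ℤ)) / ((k : ℤ) - 1))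
        + ((k : ℤ) - 1)).toNat.choose (k - 1) := by
  obtain ⟨m, rfl⟩ : ∃ m, k = m + 1 := ⟨k - 1, by omega⟩
  have hm : 0 < m := by omega
  obtain ⟨q, hq⟩ : ∃ q, q = g / m := ⟨_, rfl⟩
  obtain ⟨l, hl⟩ : ∃ l, l = g % m := ⟨_, rfl⟩
  have hg : m * q + l = g := by rw [hq, hl]; exact Nat.div_add_mod g m
  have hbound (a : ℕ) : (a : ℚ) ≤ (g : ℚ) / (((m + 1 : ℕ) : ℚ) - 1) ↔ a ≤ q := by
    have hm' : (0 : ℚ) < m := by exact_mod_cast hm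
    rw [hq, Nat.le_div_iff_mul_le hm, Nat.cast_succ, add_sub_cancel_right, le_div_iff₀ hm']
    exact_mod_cast Iff.rfl
  have hdiv : ((g : ℤ) - (l : ℤ) * ((m + 1 : ℕ) : ℤ)) / (((m + 1 : ℕ) : ℤ) - 1) = q - l := by
    have hm' : (m : ℤ) ≠ 0 := by exact_mod_cast hm.ne'
    rw [← hg, Nat.cast_succ, add_sub_cancel_right,
      show ((m * q + l : ℕ) : ℤ) - l * (m + 1) = m * (q - l) by push_cast; ring,
      Int.mul_ediv_cancel_left _ hm']
  rw [hf]
  simp only [hbound, Nat.add_sub_cancel]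
  rw [← hl, hdiv]
  rcases le_or_gt l q with h | h
  · rw [Nat.card_congr (boundedSumReflectEquiv (m + 1) q g (q - l) (by
      rw [add_mul]; omega) (Nat.sub_le _ _)), card_fin_fun_sum_eq _ _ (by omega)]
    congr 1
    omega
  · rw [Nat.choose_eq_zero_of_lt (by omega), Nat.card_eq_zero]
    refine Or.inl ⟨fun ⟨t, ht, hb⟩ => ?_⟩
    have hs : ∑ i, t i ≤ ∑ _i : Fin (m + 1), q := Finset.sum_le_sum fun i _ => hb i
    rw [ht, Finset.sum_const, Finset.card_univ, Fintype.card_fin, smul_eq_mul, add_mul] at hs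
    omega
end

section
/- Let k = 3 and α_1 = α_2 = α_3 = 1/2, and let f(g) be the number of α-communal compositions of g. Then f(g) = (g² + 6g + 8)/8 if g is even, and f(g) = (g² − 1)/8 if g is odd. -/
/-- The number of triples of natural numbers with sum `n`. -/
lemma Nat.card_fin_three_sum_eq (n : ℕ) :
    Nat.card {x : Fin 3 → ℕ // ∑ i, x i = n} = (n + 2).choose 2 := by
  rw [← Nat.card_congr (Sym.equivNatSumOfFintype (Fin 3) n), Nat.card_eq_fintype_card,
    Sym.card_sym_eq_choose, Fintype.card_fin, show 3 + n - 1 = n + 2 by omega,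
    Nat.choose_symm_add]

/-- Complementing each part in `m` is a bijection from the triples with sum `g` and parts at most
`m` onto the triples with sum `3 * m - g`, provided `2 * m ≤ g`. -/
lemma Nat.card_fin_three_sum_eq_le {g m : ℕ} (h : 2 * m ≤ g) :
    Nat.card {t : Fin 3 → ℕ // ∑ i, t i = g ∧ ∀ i, t i ≤ m} =
      Nat.card {x : Fin 3 → ℕ // ∑ i, x i + g = 3 * m} := by
  refine Nat.card_congr
    { toFun := fun t => ⟨fun i => m - t.1 i, ?_⟩
      invFun := fun x => ⟨fun i => m - x.1 i, ?_⟩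
      left_inv := ?_
      right_inv := ?_ }
  · obtain ⟨t, ht, hm⟩ := t
    simp only [Fin.sum_univ_three] at ht ⊢
    grind
  · obtain ⟨x, hx⟩ := x
    simp only [Fin.sum_univ_three] at hx ⊢
    grind
  · rintro ⟨t, ht, hm⟩
    ext i
    exact Nat.sub_sub_self (hm i)
  · rintro ⟨x, hx⟩
    ext i
    have := Finset.single_le_sum (fun j _ => Nat.zero_le (x j)) (Finset.mem_univ i)
    exact Nat.sub_sub_self (show x i ≤ m by omega)

/-- For `k = 3` and `α = (1/2, 1/2, 1/2)`, the number of
α-communal compositions of `g` is `(g² + 6g + 8)/8` if `g` is even and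
`(g² − 1)/8` if `g` is odd. -/
theorem stmt_14 (f : ℕ → ℕ)
    (hf : ∀ g : ℕ, f g = Nat.card
      {t : Fin 3 → ℕ // (∑ i, t i) = g ∧ ∀ i, (t i : ℚ) ≤ (g : ℚ) / 2})
    (g : ℕ) :
    (Even g → (f g : ℚ) = ((g : ℚ) ^ 2 + 6 * g + 8) / 8) ∧
      (Odd g → (f g : ℚ) = ((g : ℚ) ^ 2 - 1) / 8) := by
  have half (a : ℕ) : (a : ℚ) ≤ (g : ℚ) / 2 ↔ a ≤ g / 2 := by
    rw [le_div_iff₀ two_pos, Nat.le_div_iff_mul_le two_pos]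
    exact_mod_cast Iff.rfl
  have key : f g = Nat.card {x : Fin 3 → ℕ // ∑ i, x i + g = 3 * (g / 2)} := by
    rw [hf, ← Nat.card_fin_three_sum_eq_le (by omega)]
    simp only [half]
  constructor
  · rintro ⟨m, rfl⟩
    have h (x : Fin 3 → ℕ) : ∑ i, x i + (m + m) = 3 * ((m + m) / 2) ↔ ∑ i, x i = m := by omega
    rw [key, Nat.card_congr (Equiv.subtypeEquivRight h), Nat.card_fin_three_sum_eq,
      Nat.cast_choose_two]
    push_cast
    ring
  · rintro ⟨m, rfl⟩
    obtain _ | n := m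
    · have : IsEmpty {x : Fin 3 → ℕ // ∑ i, x i + (2 * 0 + 1) = 3 * ((2 * 0 + 1) / 2)} :=
        ⟨fun x => by have := x.2; omega⟩
      rw [key, Nat.card_of_isEmpty]
      norm_num
    · have h (x : Fin 3 → ℕ) : ∑ i, x i + (2 * (n + 1) + 1) = 3 * ((2 * (n + 1) + 1) / 2) ↔
          ∑ i, x i = n := by omega
      rw [key, Nat.card_congr (Equiv.subtypeEquivRight h), Nat.card_fin_three_sum_eq,
        Nat.cast_choose_two]
      push_cast
      ring
end

section
/- Fix an integer k ≥ 2, set α_i = 1/(k−1) for 1 ≤ i ≤ k, and let f(g) be the number of α-communal compositions of g. Then the generating function satisfies the formal power series identity Σ_{g=0}^∞ f(g)·x^g · (1 − x^{k})·(1 − x^{k−1})^{k} = 1 − x^{k(k−1)}. -/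
open PowerSeries in
/-- The indicator series of the residue class `r` modulo `n` is `X ^ r / (1 - X ^ n)`. -/
theorem mk_mod_eq_mul_one_sub_X_pow {n r : ℕ} (hr : r < n) :
    (PowerSeries.mk fun m => if m % n = r then (1 : ℚ) else 0) * (1 - X ^ n) = X ^ r := by
  ext m
  rw [mul_sub, mul_one, map_sub, coeff_mul_X_pow', coeff_X_pow, coeff_mk]
  by_cases hm : n ≤ m
  · have hmr : m ≠ r := by omega
    simp [hm, hmr, coeff_mk, ← Nat.mod_eq_sub_mod hm]
  · simp [hm, Nat.mod_eq_of_lt (not_le.mp hm)]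

theorem sum_mod_of_forall_mod_eq {n r : ℕ} (hr : r < n) (l : Fin (n + 1) → ℕ)
    (hl : ∀ i, l i % n = r) : (∑ i, l i) % n = r := by
  rw [Finset.sum_nat_mod, Finset.sum_congr rfl fun i _ => hl i]
  simp [add_mul, Nat.mod_eq_of_lt hr]

/-- The substitution `l i = g - n * t i` turns tuples `t` of sum `g` with `n * t i ≤ g` into
tuples of sum `g` whose entries are congruent to `g` modulo `n`. -/
def communalEquiv (n g : ℕ) (hn : 0 < n) :
    {t : Fin (n + 1) → ℕ // ∑ i, t i = g ∧ ∀ i, n * t i ≤ g} ≃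
      {l : Fin (n + 1) → ℕ // ∑ i, l i = g ∧ ∀ i, l i % n = g % n} where
  toFun t := ⟨fun i => g - n * t.1 i, by
    obtain ⟨t, ht, hle⟩ := t
    refine ⟨?_, fun i => Nat.sub_mul_mod (hle i)⟩
    have h : ∑ i, (g - n * t i) + ∑ i, n * t i = ∑ _i : Fin (n + 1), g := by
      rw [← Finset.sum_add_distrib]
      exact Finset.sum_congr rfl fun i _ => Nat.sub_add_cancel (hle i)
    rw [← Finset.mul_sum, ht] at h
    simp only [Finset.sum_const, Finset.card_univ, Fintype.card_fin, smul_eq_mul] at h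
    linarith⟩
  invFun l := ⟨fun i => (g - l.1 i) / n, by
    obtain ⟨l, hl, hmod⟩ := l
    have hle : ∀ i, l i ≤ g := fun i =>
      hl ▸ Finset.single_le_sum (fun _ _ => Nat.zero_le _) (Finset.mem_univ i)
    have hdiv : ∀ i, n * ((g - l i) / n) = g - l i := fun i =>
      Nat.mul_div_cancel' ((Nat.modEq_iff_dvd' (hle i)).mp (hmod i))
    refine ⟨?_, fun i => (hdiv i).trans_le (Nat.sub_le _ _)⟩
    have h : ∑ i, n * ((g - l i) / n) + ∑ i, l i = ∑ _i : Fin (n + 1), g := by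
      rw [← Finset.sum_add_distrib]
      exact Finset.sum_congr rfl fun i _ => by rw [hdiv, Nat.sub_add_cancel (hle i)]
    rw [← Finset.mul_sum, hl] at h
    simp only [Finset.sum_const, Finset.card_univ, Fintype.card_fin, smul_eq_mul] at h
    exact Nat.eq_of_mul_eq_mul_left hn (by linarith)⟩
  left_inv t := by
    ext i
    simp [Nat.sub_sub_self (t.2.2 i), hn]
  right_inv l := by
    obtain ⟨l, hl, hmod⟩ := l
    ext i
    have hle : l i ≤ g :=
      hl ▸ Finset.single_le_sum (fun _ _ => Nat.zero_le _) (Finset.mem_univ i)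
    simp [Nat.mul_div_cancel' ((Nat.modEq_iff_dvd' hle).mp (hmod i)), Nat.sub_sub_self hle]

/-- Tuples of sum `g` with all entries congruent to `g` modulo `n`, counted by a power series. -/
theorem card_eq_coeff_sum_pow (n g : ℕ) (hn : 0 < n) :
    (Nat.card {l : Fin (n + 1) → ℕ // ∑ i, l i = g ∧ ∀ i, l i % n = g % n} : ℚ) =
      PowerSeries.coeff g (∑ r ∈ Finset.range n,
        (PowerSeries.mk fun m => if m % n = r then (1 : ℚ) else 0) ^ (n + 1)) := by
  have hpow : ∀ p : PowerSeries ℚ, p ^ (n + 1) = ∏ _i : Fin (n + 1), p := by simp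
  simp only [hpow, map_sum, PowerSeries.coeff_prod, PowerSeries.coeff_mk, Finset.prod_boole]
  rw [Finset.sum_comm]
  trans ∑ l ∈ Finset.finsuppAntidiag (Finset.univ : Finset (Fin (n + 1))) g,
    if ∀ i, l i % n = g % n then (1 : ℚ) else 0
  swap
  · refine Finset.sum_congr rfl fun l hl => ?_
    symm
    rw [Finset.sum_eq_single (g % n)]
    · simp
    · intro r hr hne
      rw [if_neg]
      intro h
      have := sum_mod_of_forall_mod_eq (Finset.mem_range.mp hr) l fun i => h i (Finset.mem_univ i)
      rw [(Finset.mem_finsuppAntidiag.mp hl).1] at this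
      exact hne this.symm
    · exact fun h => absurd (Finset.mem_range.mpr (Nat.mod_lt g hn)) h
  rw [Finset.sum_boole, Nat.cast_inj, ← Nat.card_eq_finsetCard]
  refine Nat.card_congr (Finsupp.equivFunOnFinite.symm.subtypeEquiv fun l => ?_)
  simp [Finset.mem_finsuppAntidiag]

/-- For `α i = 1/(k−1)`, the generating function of the numbers
`f g` of α-communal compositions satisfies
`(∑ g, f(g)·x^g)·(1−x^k)·(1−x^(k−1))^k = 1 − x^(k(k−1))` over ℚ. -/
theorem stmt_15 (k : ℕ) (hk : 2 ≤ k) (f : ℕ → ℕ)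
    (hf : ∀ g : ℕ, f g = Nat.card
      {t : Fin k → ℕ // (∑ i, t i) = g ∧
        ∀ i, (t i : ℚ) ≤ (g : ℚ) / ((k : ℚ) - 1)}) :
    (PowerSeries.mk fun g => (f g : ℚ)) *
        ((1 - PowerSeries.X ^ k) * (1 - PowerSeries.X ^ (k - 1)) ^ k)
      = 1 - PowerSeries.X ^ (k * (k - 1)) := by
  obtain ⟨n, rfl⟩ : ∃ n, k = n + 1 := ⟨k - 1, by omega⟩
  have hn : 0 < n := by omega
  have hF : (PowerSeries.mk fun g => (f g : ℚ)) = ∑ r ∈ Finset.range n,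
      (PowerSeries.mk fun m => if m % n = r then (1 : ℚ) else 0) ^ (n + 1) := by
    ext g
    have hle : ∀ a : ℕ, (a : ℚ) ≤ (g : ℚ) / (((n + 1 : ℕ) : ℚ) - 1) ↔ n * a ≤ g := by
      intro a
      have hn' : (0 : ℚ) < n := by exact_mod_cast hn
      rw [Nat.cast_succ, add_sub_cancel_right, le_div_iff₀ hn', mul_comm]
      exact_mod_cast Iff.rfl
    rw [← card_eq_coeff_sum_pow n g hn, PowerSeries.coeff_mk, hf]
    simp only [hle]
    rw [Nat.card_congr (communalEquiv n g hn)]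
  rw [hF, Nat.add_sub_cancel, mul_comm (1 - _), ← mul_assoc, Finset.sum_mul]
  have hterm : ∀ r ∈ Finset.range n,
      (PowerSeries.mk fun m => if m % n = r then (1 : ℚ) else 0) ^ (n + 1) *
        (1 - PowerSeries.X ^ n) ^ (n + 1) = (PowerSeries.X ^ (n + 1)) ^ r := by
    intro r hr
    rw [← mul_pow, mk_mod_eq_mul_one_sub_X_pow (Finset.mem_range.mp hr), pow_right_comm]
  rw [Finset.sum_congr rfl hterm, geom_sum_mul_neg, ← pow_mul]
end

section
/- Let n ≥ 2 be an integer, let α_1 = α_2 = 1/2 and α_3 = 1/n, and let f(g) be the number of α-communal compositions of g. Then f(g) = (1/2)·(⌊g/n⌋ + 1)·(⌊g/n⌋ + ε_g), where ε_g = 2 if g is even and ε_g = 0 if g is odd. -/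
/-- Integer form of the communal condition for `α = (1/2, 1/2, 1/n)`. -/
lemma communal_iff {n : ℕ} (hn : 2 ≤ n) (g : ℕ) (t : Fin 3 → ℕ) :
    (∀ i, (t i : ℚ) ≤ ![(1 : ℚ)/2, 1/2, 1/(n : ℚ)] i * (g : ℚ)) ↔
      2 * t 0 ≤ g ∧ 2 * t 1 ≤ g ∧ t 2 ≤ g / n := by
  have hn' : (0 : ℚ) < n := by exact_mod_cast (by omega : 0 < n)
  have half (x : ℕ) : (x : ℚ) ≤ 1 / 2 * (g : ℚ) ↔ 2 * x ≤ g := by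
    rw [← @Nat.cast_le ℚ]
    push_cast
    constructor <;> intro h <;> linarith
  have third : (t 2 : ℚ) ≤ 1 / (n : ℚ) * (g : ℚ) ↔ t 2 ≤ g / n := by
    rw [Nat.le_div_iff_mul_le (by omega), ← @Nat.cast_le ℚ, one_div_mul_eq_div,
      le_div_iff₀ hn', Nat.cast_mul]
  simpa [Fin.forall_fin_succ, -one_div] using and_congr (half _) (and_congr (half _) third)

/-- The triples summing to `g` with first two parts at most `g / 2` and last part at most
`m ≤ g / 2` are parametrized by the last part `k` and the defect of the first part. -/
lemma card_bounded_triples (g m : ℕ) (hm : 2 * m ≤ g) :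
    Nat.card {t : Fin 3 → ℕ // (∑ i, t i) = g ∧ 2 * t 0 ≤ g ∧ 2 * t 1 ≤ g ∧ t 2 ≤ m} =
      ∑ k ∈ Finset.range (m + 1), (k + (1 - g % 2)) := by
  classical
  let S : Finset (Σ _ : ℕ, ℕ) :=
    (Finset.range (m + 1)).sigma fun k => Finset.range (k + (1 - g % 2))
  let F : (Σ _ : ℕ, ℕ) → Fin 3 → ℕ := fun p => ![g / 2 - p.2, g - p.1 - (g / 2 - p.2), p.1]
  have hF : Set.InjOn F S := by
    rintro ⟨k, a⟩ hp ⟨l, b⟩ hq h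
    have h0 := congrFun h 0
    have h2 := congrFun h 2
    simp [S] at hp hq
    simp [F] at h0 h2
    obtain rfl : k = l := h2
    obtain rfl : a = b := by omega
    rfl
  rw [Nat.subtype_card (S.image F), Finset.card_image_of_injOn hF, Finset.card_sigma]
  · simp
  · intro t
    simp only [Finset.mem_image, Fin.sum_univ_three]
    constructor
    · rintro ⟨⟨k, a⟩, hp, rfl⟩
      simp [S] at hp
      simp [F]
      omega
    · rintro ⟨hs, h0, h1, h2⟩
      refine ⟨⟨t 2, g / 2 - t 0⟩, ?_, ?_⟩
      · simp [S]
        omega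
      · ext i
        fin_cases i <;> simp [F] <;> omega

/-- For `α = (1/2, 1/2, 1/n)` with `n ≥ 2`, the number of
α-communal compositions of `g` is `(1/2)·(⌊g/n⌋ + 1)·(⌊g/n⌋ + ε_g)` where
`ε_g = 2` if `g` is even and `ε_g = 0` if `g` is odd. -/
theorem stmt_16 (n : ℕ) (hn : 2 ≤ n) (f : ℕ → ℕ)
    (hf : ∀ g : ℕ, f g = Nat.card
      {t : Fin 3 → ℕ // (∑ i, t i) = g ∧
        ∀ i, (t i : ℚ) ≤ ![(1 : ℚ)/2, 1/2, 1/(n : ℚ)] i * (g : ℚ)})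
    (g : ℕ) :
    (f g : ℚ) = (1 / 2) * (((g / n : ℕ) : ℚ) + 1) *
      (((g / n : ℕ) : ℚ) + if Even g then 2 else 0) := by
  have hm : 2 * (g / n) ≤ g :=
    (Nat.mul_le_mul_right _ hn).trans (Nat.mul_div_le g n)
  have sum_range_add (m e : ℕ) : ((∑ k ∈ Finset.range (m + 1), (k + e) : ℕ) : ℚ) =
      1 / 2 * ((m : ℚ) + 1) * (m + 2 * e) := by
    induction m with
    | zero => simp
    | succ m ih =>
      rw [Finset.sum_range_succ, Nat.cast_add, ih]
      push_cast
      ring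
  simp only [hf, communal_iff hn]
  rw [card_bounded_triples g _ hm, sum_range_add]
  rcases Nat.mod_two_eq_zero_or_one g with h | h
  · simp [h, Nat.even_iff]
  · simp [h, Nat.even_iff]
end

section
/- Let n ≥ 3 be an odd integer, let α_1 = α_2 = 1/2 and α_3 = 1/n, and let f(g) be the number of α-communal compositions of g. Then the generating function satisfies the formal power series identity Σ_{g=0}^∞ f(g)·x^g · (1 − x^{2})(1 − x^{n})(1 − x^{2n}) = 1 + 2x^{n+1} + x^{2n}. -/
/-- The number of `(1/2, 1/2, 1/n)`-communal compositions of `g`, in closed form. -/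
theorem card_communal_compositions (n : ℕ) (hn : 3 ≤ n) (g : ℕ) :
    Nat.card {t : Fin 3 → ℕ // (∑ i, t i) = g ∧
        ∀ i, (t i : ℚ) ≤ ![(1 : ℚ)/2, 1/2, 1/(n : ℚ)] i * (g : ℚ)}
      = (g / n + 2 - g % 2).choose 2 := by
  have hn0 : 0 < n := by omega
  have hnq : (0 : ℚ) < n := by exact_mod_cast hn0
  have hmem (t : Fin 3 → ℕ) : ((∑ i, t i) = g ∧
      ∀ i, (t i : ℚ) ≤ ![(1 : ℚ)/2, 1/2, 1/(n : ℚ)] i * (g : ℚ)) ↔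
      t 0 + t 1 + t 2 = g ∧ t 0 ≤ g / 2 ∧ t 1 ≤ g / 2 ∧ t 2 ≤ g / n := by
    have half (a : ℕ) : (a : ℚ) ≤ 1 / 2 * (g : ℚ) ↔ a ≤ g / 2 := by
      rw [Nat.le_div_iff_mul_le two_pos, ← Nat.cast_le (α := ℚ)]
      push_cast
      constructor <;> intro h <;> linarith
    have nth (a : ℕ) : (a : ℚ) ≤ 1 / (n : ℚ) * (g : ℚ) ↔ a ≤ g / n := by
      rw [Nat.le_div_iff_mul_le hn0, ← Nat.cast_le (α := ℚ), one_div_mul_eq_div,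
        le_div_iff₀ hnq]
      push_cast
      rfl
    simp only [Fin.forall_fin_succ, Fin.sum_univ_three]
    simpa using fun _ => by simpa using and_congr (half (t 0)) (and_congr (half (t 1)) (nth (t 2)))
  have hle : g / n ≤ g / 2 := Nat.div_le_div_left (by omega) two_pos
  let e : {t : Fin 3 → ℕ // (∑ i, t i) = g ∧
        ∀ i, (t i : ℚ) ≤ ![(1 : ℚ)/2, 1/2, 1/(n : ℚ)] i * (g : ℚ)} ≃
      (Finset.range (g / n + 1)).sigma fun c => Finset.Icc (g - c - g / 2) (g / 2) :=
    { toFun := fun t => ⟨⟨t.1 2, t.1 0⟩, by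
        have := (hmem t.1).1 t.2
        simp only [Finset.mem_sigma, Finset.mem_range, Finset.mem_Icc]
        omega⟩
      invFun := fun p => ⟨![p.1.2, g - p.1.1 - p.1.2, p.1.1], (hmem _).2 (by
        have := p.2
        simp only [Finset.mem_sigma, Finset.mem_range, Finset.mem_Icc] at this
        simp only [Matrix.cons_val]
        omega)⟩
      left_inv := fun t => by
        have := (hmem t.1).1 t.2
        ext i
        fin_cases i <;> simp
        omega
      right_inv := fun p => rfl }
  rw [Nat.card_congr e, Nat.card_eq_fintype_card, Fintype.card_coe, Finset.card_sigma]
  have hcard : ∀ c ∈ Finset.range (g / n + 1),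
      (Finset.Icc (g - c - g / 2) (g / 2)).card = c + 1 - g % 2 := by
    intro c hc
    rw [Finset.mem_range] at hc
    rw [Nat.card_Icc]
    omega
  rw [Finset.sum_congr rfl hcard]
  generalize g / n = m
  induction m with
  | zero => rcases Nat.mod_two_eq_zero_or_one g with h | h <;> simp [h]
  | succ m ih =>
    rw [Finset.sum_range_succ, ih]
    have hstep : m + 1 + 2 - g % 2 = (m + 2 - g % 2) + 1 := by omega
    rw [hstep, Nat.choose_succ_succ' _ 1, Nat.choose_one_right, one_add_one_eq_two]
    omega

/-- Over `ℚ`, the closed form after multiplication by `(1 - x ^ n) * (1 - x ^ (2 * n))`. -/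
theorem choose_recurrence (n : ℕ) (hn : 3 ≤ n) (hodd : Odd n) (u : ℕ → ℚ)
    (hu : ∀ g, u g = ((g / n + 2 - g % 2).choose 2 : ℕ)) (g : ℕ) :
    u g - (if n ≤ g then u (g - n) else 0) - (if 2 * n ≤ g then u (g - 2 * n) else 0)
      + (if 3 * n ≤ g then u (g - 3 * n) else 0)
    = if Even g then 1 + (if n + 1 ≤ g then 2 else 0) + (if 2 * n ≤ g then 1 else 0) else 0 := by
  have hn0 : 0 < n := by omega
  obtain ⟨m, r, hr, rfl⟩ : ∃ m r, r < n ∧ g = r + n * m :=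
    ⟨g / n, g % n, Nat.mod_lt _ hn0, (Nat.mod_add_div g n).symm⟩
  have key (k : ℕ) : u (r + n * k) = ((k + 2 - (r + k) % 2).choose 2 : ℕ) := by
    rw [hu, Nat.add_mul_div_left _ _ hn0, Nat.div_eq_of_lt hr, zero_add, Nat.add_mod,
      Nat.mul_mod, Nat.odd_iff.1 hodd, one_mul, Nat.mod_mod, ← Nat.add_mod]
  have hpar : Even (r + n * m) ↔ (r + m) % 2 = 0 := by
    rw [← Nat.even_iff, Nat.even_add, Nat.even_add, Nat.even_mul]
    simp [Nat.not_even_iff_odd.2 hodd]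
  simp only [hpar]
  rcases m with _ | _ | _ | m
  · have h1 : ¬ n ≤ r + n * 0 := by omega
    have h2 : ¬ 2 * n ≤ r + n * 0 := by omega
    have h3 : ¬ 3 * n ≤ r + n * 0 := by omega
    have h4 : ¬ n + 1 ≤ r + n * 0 := by omega
    simp only [h1, h2, h3, h4, if_false, key]
    rcases Nat.mod_two_eq_zero_or_one r with h | h <;> simp [h]
  · have e1 : r + n * 1 - n = r + n * 0 := by omega
    have h1 : n ≤ r + n * 1 := by omega
    have h2 : ¬ 2 * n ≤ r + n * 1 := by omega
    have h3 : ¬ 3 * n ≤ r + n * 1 := by omega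
    simp only [zero_add, e1, h1, h2, h3, if_true, if_false, key]
    rcases Nat.mod_two_eq_zero_or_one r with h | h
    · have hsucc : (r + 1) % 2 = 1 := by omega
      simp [h, hsucc]
    · have hsucc : (r + 1) % 2 = 0 := by omega
      have h4 : n + 1 ≤ r + n * 1 := by omega
      simp only [add_zero, h, hsucc, h4, if_true]
      norm_num [Nat.choose]
  · have e1 : r + n * 2 - n = r + n * 1 := by omega
    have e2 : r + n * 2 - 2 * n = r + n * 0 := by omega
    have h1 : n ≤ r + n * 2 := by omega
    have h2 : 2 * n ≤ r + n * 2 := by omega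
    have h3 : ¬ 3 * n ≤ r + n * 2 := by omega
    have h4 : n + 1 ≤ r + n * 2 := by omega
    simp only [zero_add, Nat.reduceAdd, e1, e2, h1, h2, h3, h4, if_true, if_false, key]
    rcases Nat.mod_two_eq_zero_or_one r with h | h
    · have : (r + 1) % 2 = 1 := by omega
      simp [*]
      norm_num [Nat.choose]
    · have : (r + 1) % 2 = 0 := by omega
      simp [*]
  · have e0 : r + n * (m + 1 + 1 + 1) = r + n * m + 3 * n := by ring
    have e1 : r + n * m + 3 * n - n = r + n * (m + 2) := by rw [mul_add]; omega
    have e2 : r + n * m + 3 * n - 2 * n = r + n * (m + 1) := by rw [mul_add]; omega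
    have e3 : r + n * m + 3 * n - 3 * n = r + n * m := by omega
    have h1 : n ≤ r + n * m + 3 * n := by omega
    have h2 : 2 * n ≤ r + n * m + 3 * n := by omega
    have h3 : 3 * n ≤ r + n * m + 3 * n := by omega
    have h4 : n + 1 ≤ r + n * m + 3 * n := by omega
    rw [key]
    simp only [e0, e1, e2, e3, h1, h2, h3, h4, if_true, key]
    rcases Nat.mod_two_eq_zero_or_one (r + m) with h | h
    · have a1 : (r + (m + 1)) % 2 = 1 := by omega
      have a2 : (r + (m + 2)) % 2 = 0 := by omega
      have a3 : (r + (m + 1 + 1 + 1)) % 2 = 1 := by omega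
      simp [h, a1, a2, a3]
    · have a1 : (r + (m + 1)) % 2 = 0 := by omega
      have a2 : (r + (m + 2)) % 2 = 1 := by omega
      have a3 : (r + (m + 1 + 1 + 1)) % 2 = 0 := by omega
      simp [h, a1, a2, a3, Nat.cast_choose_two]
      ring

/-- For `α = (1/2, 1/2, 1/n)` with `n ≥ 3` odd, the generating
function satisfies
`(∑ g, f(g)·x^g)·(1−x²)(1−xⁿ)(1−x^{2n}) = 1 + 2x^{n+1} + x^{2n}` over ℚ. -/
theorem stmt_17 (n : ℕ) (hn : 3 ≤ n) (hodd : Odd n) (f : ℕ → ℕ)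
    (hf : ∀ g : ℕ, f g = Nat.card
      {t : Fin 3 → ℕ // (∑ i, t i) = g ∧
        ∀ i, (t i : ℚ) ≤ ![(1 : ℚ)/2, 1/2, 1/(n : ℚ)] i * (g : ℚ)}) :
    (PowerSeries.mk fun g => (f g : ℚ)) *
        ((1 - PowerSeries.X ^ 2) * (1 - PowerSeries.X ^ n) *
          (1 - PowerSeries.X ^ (2 * n)))
      = 1 + 2 * PowerSeries.X ^ (n + 1) + PowerSeries.X ^ (2 * n) := by
  have hF : (PowerSeries.mk fun g => (f g : ℚ)) *
      (1 - PowerSeries.X ^ n - PowerSeries.X ^ (2 * n) + PowerSeries.X ^ (3 * n)) =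
      PowerSeries.mk fun g => if Even g then
        1 + (if n + 1 ≤ g then 2 else 0) + (if 2 * n ≤ g then 1 else 0) else 0 := by
    ext g
    rw [PowerSeries.coeff_mk, ← choose_recurrence n hn hodd (fun g => (f g : ℚ))
      (fun g => by rw [hf, card_communal_compositions n hn])]
    simp only [mul_add, mul_sub, mul_one, map_add, map_sub, PowerSeries.coeff_mul_X_pow',
      PowerSeries.coeff_mk]
  have hH : (PowerSeries.mk fun g => if Even g then
        1 + (if n + 1 ≤ g then 2 else 0) + (if 2 * n ≤ g then (1 : ℚ) else 0) else 0) *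
      (1 - PowerSeries.X ^ 2) =
      1 + 2 * PowerSeries.X ^ (n + 1) + PowerSeries.X ^ (2 * n) := by
    have h2 : (2 : PowerSeries ℚ) = PowerSeries.C 2 := (map_ofNat PowerSeries.C 2).symm
    ext g
    rw [h2]
    simp only [mul_sub, mul_one, map_add, map_sub, PowerSeries.coeff_mul_X_pow',
      PowerSeries.coeff_mk, PowerSeries.coeff_C, PowerSeries.coeff_X_pow,
      PowerSeries.coeff_one, Nat.even_iff]
    have := Nat.odd_iff.1 hodd
    split_ifs <;> first | omega | norm_num
  rw [← hH, ← hF]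
  ring
end

section
/- Let α_1 = 1/3, α_2 = 2/5, α_3 = 2/7, and let f(g) be the number of α-communal compositions of g. Then the generating function satisfies the formal power series identity Σ_{g=0}^∞ f(g)·x^g · (1 − x^{15})(1 − x^{21})(1 − x^{35}) = 1 + x^{18} + x^{25} + x^{28}; in particular f(100) = 3 and f(101) = 1. -/
/-- The generating function of a set `S` with respect to a weight `w`. -/
noncomputable def weightSeries {α : Type*} (w : α → ℕ) (S : Set α) : PowerSeries ℚ :=
  PowerSeries.mk fun n => ({x ∈ S | w x = n}.ncard : ℚ)

/-- Removing from `S` a copy of itself shifted in weight by `d` multiplies its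
generating function by `1 - X ^ d`. -/
theorem weightSeries_mul_one_sub_X_pow {α : Type*} {w : α → ℕ}
    (hw : ∀ n, {x | w x = n}.Finite) {S : Set α} {φ : α → α} (hφ : φ.Injective) {d : ℕ}
    (hd : ∀ x, w (φ x) = w x + d) (hS : ∀ x ∈ S, φ x ∈ S) :
    weightSeries w S * (1 - PowerSeries.X ^ d) = weightSeries w (S \ φ '' S) := by
  ext n
  rw [mul_sub, mul_one, map_sub, PowerSeries.coeff_mul_X_pow']
  simp only [weightSeries, PowerSeries.coeff_mk]
  have hfin : ∀ (T : Set α) m, {x ∈ T | w x = m}.Finite := fun T m =>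
    (hw m).subset fun x hx => hx.2
  split_ifs with h
  · have hunion : {x ∈ S | w x = n} =
        {x ∈ S \ φ '' S | w x = n} ∪ φ '' {x ∈ S | w x = n - d} := by
      ext x
      constructor
      · rintro ⟨hx, hxn⟩
        by_cases hi : x ∈ φ '' S
        · obtain ⟨y, hy, rfl⟩ := hi
          exact Or.inr ⟨y, ⟨hy, by have := hd y; omega⟩, rfl⟩
        · exact Or.inl ⟨⟨hx, hi⟩, hxn⟩
      · rintro (⟨⟨hx, -⟩, hxn⟩ | ⟨y, ⟨hy, hyn⟩, rfl⟩)
        · exact ⟨hx, hxn⟩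
        · exact ⟨hS y hy, by have := hd y; omega⟩
    have hdisj : Disjoint {x ∈ S \ φ '' S | w x = n} (φ '' {x ∈ S | w x = n - d}) := by
      rw [Set.disjoint_left]
      rintro x ⟨⟨-, hx⟩, -⟩ ⟨y, ⟨hy, -⟩, rfl⟩
      exact hx ⟨y, hy, rfl⟩
    rw [hunion, Set.ncard_union_eq hdisj (hfin _ _) ((hfin _ _).image _),
      Set.ncard_image_of_injective _ hφ]
    push_cast
    ring
  · rw [sub_zero]
    congr 2
    ext x
    refine ⟨fun ⟨hx, hxn⟩ => ⟨⟨hx, ?_⟩, hxn⟩, fun ⟨hx, hxn⟩ => ⟨hx.1, hxn⟩⟩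
    rintro ⟨y, -, rfl⟩
    have := hd y
    omega

/-- The generating function of a finite set is the sum of its monomials. -/
theorem weightSeries_coe_finset {α : Type*} [DecidableEq α] (w : α → ℕ) (T : Finset α) :
    weightSeries w (T : Set α) = ∑ x ∈ T, PowerSeries.X ^ w x := by
  ext n
  have hset : {x ∈ (T : Set α) | w x = n} = ((T.filter fun x => w x = n : Finset α) : Set α) := by
    ext x
    simp
  simp only [weightSeries, PowerSeries.coeff_mk, map_sum, PowerSeries.coeff_X_pow]
  rw [hset, Set.ncard_coe_finset, Finset.card_filter]
  push_cast
  exact Finset.sum_congr rfl fun x _ => by simp only [eq_comm]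

/-- The cone of all communal compositions for `(1/3, 2/5, 2/7)`. -/
def communalCone : Set (Fin 3 → ℕ) :=
  {t | 3 * t 0 ≤ t 0 + t 1 + t 2 ∧ 5 * t 1 ≤ 2 * (t 0 + t 1 + t 2) ∧
    7 * t 2 ≤ 2 * (t 0 + t 1 + t 2)}

theorem finite_sum_eq (n : ℕ) : {t : Fin 3 → ℕ | ∑ i, t i = n}.Finite :=
  (Set.finite_Iic fun _ : Fin 3 => n).subset fun t ht i => by
    rw [← Set.mem_ofPred.mp ht]
    exact Finset.single_le_sum (fun j _ => Nat.zero_le (t j)) (Finset.mem_univ i)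

theorem mem_image_add_right_iff {S : Set (Fin 3 → ℕ)} {t : Fin 3 → ℕ} {a b c : ℕ} :
    t ∈ (fun s => s + ![a, b, c]) '' S ↔
      a ≤ t 0 ∧ b ≤ t 1 ∧ c ≤ t 2 ∧ ![t 0 - a, t 1 - b, t 2 - c] ∈ S := by
  constructor
  · rintro ⟨s, hs, rfl⟩
    refine ⟨by simp, by simp, by simp, ?_⟩
    convert hs using 1
    ext i
    fin_cases i <;> simp
  · rintro ⟨ha, hb, hc, h⟩
    refine ⟨_, h, ?_⟩
    ext i
    fin_cases i <;> simp [ha, hb, hc]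

theorem communalCone_sdiff :
    communalCone \ (fun s => s + ![5, 6, 4]) '' communalCone =
      {t ∈ communalCone | 2 * (t 0 + t 1 + t 2) < 7 * t 2 + 2} := by
  ext t
  simp only [Set.mem_sdiff, mem_image_add_right_iff, communalCone, Set.mem_ofPred_eq,
    Matrix.cons_val]
  omega

theorem communalCone_facet_sdiff :
    {t ∈ communalCone | 2 * (t 0 + t 1 + t 2) < 7 * t 2 + 2} \ (fun s => s + ![7, 8, 6]) ''
        {t ∈ communalCone | 2 * (t 0 + t 1 + t 2) < 7 * t 2 + 2} =
      {t ∈ communalCone | 2 * (t 0 + t 1 + t 2) < 7 * t 2 + 2 ∧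
        2 * (t 0 + t 1 + t 2) < 5 * t 1 + 2} := by
  ext t
  simp only [Set.mem_sdiff, mem_image_add_right_iff, communalCone, Set.mem_ofPred_eq,
    Matrix.cons_val]
  omega

theorem communalCone_ray_sdiff :
    {t ∈ communalCone | 2 * (t 0 + t 1 + t 2) < 7 * t 2 + 2 ∧
        2 * (t 0 + t 1 + t 2) < 5 * t 1 + 2} \ (fun s => s + ![11, 14, 10]) ''
        {t ∈ communalCone | 2 * (t 0 + t 1 + t 2) < 7 * t 2 + 2 ∧
          2 * (t 0 + t 1 + t 2) < 5 * t 1 + 2} =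
      (({![0, 0, 0], ![6, 7, 5], ![8, 10, 7], ![9, 11, 8]} : Finset (Fin 3 → ℕ)) :
        Set (Fin 3 → ℕ)) := by
  ext t
  simp only [Set.mem_sdiff, mem_image_add_right_iff, communalCone, Set.mem_ofPred_eq,
    Matrix.cons_val, Finset.coe_insert, Finset.coe_singleton, Set.mem_insert_iff,
    Set.mem_singleton_iff, funext_iff, Fin.forall_fin_succ, Fin.succ_zero_eq_one,
    Fin.succ_one_eq_two, IsEmpty.forall_iff, and_true]
  constructor
  · intro h
    have h₀ : t 0 + t 1 + t 2 = 3 * t 0 ∨ t 0 + t 1 + t 2 = 3 * t 0 + 1 := by omega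
    have h₁ : 2 * (t 0 + t 1 + t 2) = 5 * t 1 ∨ 2 * (t 0 + t 1 + t 2) = 5 * t 1 + 1 := by omega
    have h₂ : 2 * (t 0 + t 1 + t 2) = 7 * t 2 ∨ 2 * (t 0 + t 1 + t 2) = 7 * t 2 + 1 := by omega
    clear h
    rcases h₀ with h₀ | h₀ <;> rcases h₁ with h₁ | h₁ <;> rcases h₂ with h₂ | h₂ <;>
    first
    | (exfalso; omega)
    | exact Or.inl ⟨by omega, by omega, by omega⟩
    | exact Or.inr (Or.inl ⟨by omega, by omega, by omega⟩)
    | exact Or.inr (Or.inr (Or.inl ⟨by omega, by omega, by omega⟩))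
    | exact Or.inr (Or.inr (Or.inr ⟨by omega, by omega, by omega⟩))
  · omega

theorem weightSeries_communalCone :
    weightSeries (fun t : Fin 3 → ℕ => ∑ i, t i) communalCone *
        ((1 - PowerSeries.X ^ 15) * (1 - PowerSeries.X ^ 21) * (1 - PowerSeries.X ^ 35)) =
      1 + PowerSeries.X ^ 18 + PowerSeries.X ^ 25 + PowerSeries.X ^ 28 := by
  rw [← mul_assoc, ← mul_assoc,
    weightSeries_mul_one_sub_X_pow finite_sum_eq (φ := fun s => s + ![5, 6, 4])
      (add_left_injective _), communalCone_sdiff,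
    weightSeries_mul_one_sub_X_pow finite_sum_eq (φ := fun s => s + ![7, 8, 6])
      (add_left_injective _), communalCone_facet_sdiff,
    weightSeries_mul_one_sub_X_pow finite_sum_eq (φ := fun s => s + ![11, 14, 10])
      (add_left_injective _), communalCone_ray_sdiff, weightSeries_coe_finset]
  · rw [Finset.sum_insert (by decide), Finset.sum_insert (by decide),
      Finset.sum_insert (by decide), Finset.sum_singleton]
    simp [Fin.sum_univ_three, add_assoc]
  all_goals
    intro t
    simp only [communalCone, Set.mem_ofPred_eq, Fin.sum_univ_three, Pi.add_apply,
      Matrix.cons_val]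
    omega

theorem card_communal_eq_ncard (g : ℕ) :
    Nat.card {t : Fin 3 → ℕ // (∑ i, t i) = g ∧
        ∀ i, (t i : ℚ) ≤ ![(1 : ℚ)/3, 2/5, 2/7] i * (g : ℚ)} =
      {t ∈ communalCone | ∑ i, t i = g}.ncard := by
  rw [← Nat.card_coe_set_eq]
  refine Nat.card_congr (Equiv.subtypeEquivRight fun t => ?_)
  rw [Set.mem_ofPred_eq, and_comm]
  refine and_congr_left fun hg => ?_
  subst hg
  simp only [communalCone, Set.mem_ofPred_eq, Fin.forall_fin_succ, Fin.succ_zero_eq_one,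
    Fin.succ_one_eq_two, IsEmpty.forall_iff, and_true, Matrix.cons_val, Fin.sum_univ_three]
  rify
  refine and_congr ?_ (and_congr ?_ ?_) <;> constructor <;> intro h <;> linarith

theorem communalCone_sum_eq_hundred :
    {t ∈ communalCone | ∑ i, t i = 100} =
      (({![33, 40, 27], ![33, 39, 28], ![32, 40, 28]} : Finset (Fin 3 → ℕ)) :
        Set (Fin 3 → ℕ)) := by
  ext t
  simp only [communalCone, Set.mem_ofPred_eq, Fin.sum_univ_three,
    Matrix.cons_val, Finset.coe_insert, Finset.coe_singleton, Set.mem_insert_iff,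
    Set.mem_singleton_iff, funext_iff, Fin.forall_fin_succ, Fin.succ_zero_eq_one,
    Fin.succ_one_eq_two, IsEmpty.forall_iff, and_true]
  omega

theorem communalCone_sum_eq_hundred_one :
    {t ∈ communalCone | ∑ i, t i = 101} = {![33, 40, 28]} := by
  ext t
  simp only [communalCone, Set.mem_ofPred_eq, Fin.sum_univ_three,
    Matrix.cons_val, Set.mem_singleton_iff, funext_iff, Fin.forall_fin_succ,
    Fin.succ_zero_eq_one, Fin.succ_one_eq_two, IsEmpty.forall_iff, and_true]
  omega

/-- For `α = (1/3, 2/5, 2/7)`, the generating function satisfies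
`(∑ g, f(g)·x^g)·(1−x^15)(1−x^21)(1−x^35) = 1 + x^18 + x^25 + x^28` over ℚ;
in particular `f 100 = 3` and `f 101 = 1`. -/
theorem stmt_19 (f : ℕ → ℕ)
    (hf : ∀ g : ℕ, f g = Nat.card
      {t : Fin 3 → ℕ // (∑ i, t i) = g ∧
        ∀ i, (t i : ℚ) ≤ ![(1 : ℚ)/3, 2/5, 2/7] i * (g : ℚ)}) :
    ((PowerSeries.mk fun g => (f g : ℚ)) *
        ((1 - PowerSeries.X ^ 15) * (1 - PowerSeries.X ^ 21) *
          (1 - PowerSeries.X ^ 35))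
      = 1 + PowerSeries.X ^ 18 + PowerSeries.X ^ 25 + PowerSeries.X ^ 28) ∧
      f 100 = 3 ∧ f 101 = 1 := by
  simp only [card_communal_eq_ncard] at hf
  refine ⟨?_, ?_, ?_⟩
  · simp only [hf]
    exact weightSeries_communalCone
  · rw [hf, communalCone_sum_eq_hundred, Set.ncard_coe_finset]
    decide
  · rw [hf, communalCone_sum_eq_hundred_one, Set.ncard_singleton]
end
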